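/- Let n ≥ 1, k > 0, δ > 0, g₁ > 0, T* > 0, ΔT > 0, and T = T* + ΔT. Suppose there exist positive constants χ, λ₀, λ₁, λ₂ such that Φ₀ is positive definite, Ψ₁ = −k + (1 + k²n)χ ≤ 0, Ψ₂ is negative semidefinite, and Φ is negative definite. Let z₀ ∈ C¹(Ω) vanish on Γ_D and z₁ ∈ C(Ω). For m = 1, 2, …, let e^{(m)} be a classical (C²) solution on Ω × [t₀, t₀+T] of e_tt = Δe + g^{(m)}(x,t)e with e = 0 on Γ_D and e_{x_p} = −k e_t on each face {x_p = 1}, and let e^{b(m)} be a classical solution of e_tt = Δe + g^{b(m)}(x,t)e with e = 0 on Γ_D and e_{x_p} = +k e_t on each face {x_p = 1}, where all coefficients g^{(m)}, g^{b(m)} are continuous with absolute value ≤ g₁. Assume the coupling conditions: e^{(1)}(·,t₀) = z₀ and e_t^{(1)}(·,t₀) = z₁; for m ≥ 2, e^{(m)}(·,t₀) = e^{b(m−1)}(·,t₀) and e_t^{(m)}(·,t₀) = e_t^{b(m−1)}(·,t₀); and for all m ≥ 1, e^{b(m)}(·,t₀+T) = e^{(m)}(·,t₀+T) and e_t^{b(m)}(·,t₀+T)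 = e_t^{(m)}(·,t₀+T). Then for all m ≥ 1, ∫_Ω ( |∇e^{b(m)}(x,t₀)|² + e_t^{b(m)}(x,t₀)² ) dx ≤ (β/α) q^m ∫_Ω ( |∇z₀(x)|² + z₁(x)² ) dx, where q = e^{−4δΔT}, α = 2λ_min(Φ₀) and β = 2(1 + 4/(π²n))λ_max(Φ₁) + χk(n−1) with Φ₁ = Φ₀ + diag(4λ₀/(π²n), 0, 0). -/

import Mathlib

open MeasureTheory Real Matrix

noncomputable section

/-- The closed unit hypercube `[0,1]^n`. -/
def cube (n : ℕ) : Set (Fin n → ℝ) := Set.univ.pi fun _ => Set.Icc (0:ℝ) 1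

/-- Partial derivative of `u` in the `p`-th coordinate direction. -/
def pd {n : ℕ} (p : Fin n) (u : (Fin n → ℝ) → ℝ) (x : Fin n → ℝ) : ℝ :=
  fderiv ℝ u x (Pi.single p 1)

/-- Squared Euclidean norm of the gradient, `|∇u|²`. -/
def gradSq {n : ℕ} (u : (Fin n → ℝ) → ℝ) (x : Fin n → ℝ) : ℝ := ∑ p, (pd p u x) ^ 2

/-- Laplacian `Δu = Σ_p u_{x_p x_p}`. -/
def lap {n : ℕ} (u : (Fin n → ℝ) → ℝ) (x : Fin n → ℝ) : ℝ := ∑ p, pd p (pd p u) x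

/-- Surface integral over `Γ_N`: `Σ_p ∫_{[0,1]^{n-1}} h|_{x_p = 1} dx'`
(each face integral realized as an integral over the cube of a function
independent of the `p`-th coordinate). -/
def faceInt {n : ℕ} (h : (Fin n → ℝ) → ℝ) : ℝ :=
  ∑ p : Fin n, ∫ x in cube n, h (Function.update x p 1)

/-- `xᵀ∇u`. -/
def xGrad {n : ℕ} (u : (Fin n → ℝ) → ℝ) (x : Fin n → ℝ) : ℝ := ∑ p, x p * pd p u x

/-- Minimal eigenvalue of a symmetric matrix, via the Rayleigh quotient. -/
def lamMin (M : Matrix (Fin 3) (Fin 3) ℝ) : ℝ :=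
  sInf {r | ∃ v : Fin 3 → ℝ, (∑ i, (v i) ^ 2) = 1 ∧ r = v ⬝ᵥ M.mulVec v}

/-- Maximal eigenvalue of a symmetric matrix, via the Rayleigh quotient. -/
def lamMax (M : Matrix (Fin 3) (Fin 3) ℝ) : ℝ :=
  sSup {r | ∃ v : Fin 3 → ℝ, (∑ i, (v i) ^ 2) = 1 ∧ r = v ⬝ᵥ M.mulVec v}

/-- Negative definiteness. -/
def NegDefM {m : ℕ} (M : Matrix (Fin m) (Fin m) ℝ) : Prop := (-M).PosDef

/-- Negative semidefiniteness. -/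
def NegSemidefM {m : ℕ} (M : Matrix (Fin m) (Fin m) ℝ) : Prop := (-M).PosSemidef

/-- The matrix `Φ₀` of LMI (12). -/
def Phi0 (n : ℕ) (χ lam0 : ℝ) : Matrix (Fin 3) (Fin 3) ℝ :=
  !![1/2 - 4*lam0/(π^2*n), Real.sqrt n * χ, 0;
     Real.sqrt n * χ, 1/2, ((n:ℝ)-1)*χ/2;
     0, ((n:ℝ)-1)*χ/2, lam0]

/-- `Φ₁ = Φ₀ + diag(4λ₀/(π²n), 0, 0)`. -/
def Phi1 (n : ℕ) (χ lam0 : ℝ) : Matrix (Fin 3) (Fin 3) ℝ :=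
  Phi0 n χ lam0 + Matrix.diagonal ![4*lam0/(π^2*n), 0, 0]

/-- The matrix `Ψ₂` of LMI (14). -/
def Psi2 (n : ℕ) (k χ δ g1 lam1 : ℝ) : Matrix (Fin 3) (Fin 3) ℝ :=
  !![-χ + δ*(1 + χ*k*((n:ℝ)-1)) + 4*lam1/(π^2*n), 2*δ*Real.sqrt n*χ, Real.sqrt n*g1*χ;
     2*δ*Real.sqrt n*χ, -χ + δ, g1/2 + δ*((n:ℝ)-1)*χ;
     Real.sqrt n*g1*χ, g1/2 + δ*((n:ℝ)-1)*χ, -lam1 + g1*((n:ℝ)-1)*χ]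

/-- The matrix `Φ` of the exact-observability LMI (32), with `σ = e^{-2δT*}`. -/
def PhiM (n : ℕ) (χ σ lam2 : ℝ) : Matrix (Fin 3) (Fin 3) ℝ :=
  !![-(1-σ)/2 + 4*lam2/(π^2*n), Real.sqrt n*(1+σ)*χ, 0;
     Real.sqrt n*(1+σ)*χ, -(1-σ)/2, ((n:ℝ)-1)*(1+σ)*χ/2;
     0, ((n:ℝ)-1)*(1+σ)*χ/2, -lam2]

/-- `α = 2λ_min(Φ₀)`. -/
def alphaC (n : ℕ) (χ lam0 : ℝ) : ℝ := 2 * lamMin (Phi0 n χ lam0)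

/-- `β = 2(1 + 4/(π²n))λ_max(Φ₁) + χk(n−1)`. -/
def betaC (n : ℕ) (k χ lam0 : ℝ) : ℝ :=
  2 * (1 + 4/(π^2*n)) * lamMax (Phi1 n χ lam0) + χ*k*((n:ℝ)-1)

lemma isCompact_cube (n : ℕ) : IsCompact (cube n) :=
  isCompact_univ_pi fun _ => isCompact_Icc

lemma measurableSet_cube (n : ℕ) : MeasurableSet (cube n) :=
  (isCompact_cube n).isClosed.measurableSet

lemma update_mem_cube {n : ℕ} {x : Fin n → ℝ} (hx : x ∈ cube n) (p : Fin n) {s : ℝ}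
    (hs : s ∈ Set.Icc (0 : ℝ) 1) : Function.update x p s ∈ cube n := by
  intro q _
  by_cases h : q = p
  · subst h; simpa using hs
  · simpa [h] using hx q trivial

lemma integrableOn_cube {n : ℕ} {h : (Fin n → ℝ) → ℝ} (hh : Continuous h) :
    IntegrableOn h (cube n) :=
  hh.continuousOn.integrableOn_compact (isCompact_cube n)

lemma integral_cube_mono {n : ℕ} {f g : (Fin n → ℝ) → ℝ} (hf : Continuous f)
    (hg : Continuous g) (h : ∀ x ∈ cube n, f x ≤ g x) :
    ∫ x in cube n, f x ≤ ∫ x in cube n, g x :=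
  setIntegral_mono_on (integrableOn_cube hf) (integrableOn_cube hg) (measurableSet_cube n) h

lemma continuous_update_pair {n : ℕ} (p : Fin n) :
    Continuous fun q : (Fin n → ℝ) × ℝ => Function.update q.1 p q.2 :=
  continuous_fst.update p continuous_snd

lemma continuous_update_left {n : ℕ} (p : Fin n) (s : ℝ) :
    Continuous fun x : Fin n → ℝ => Function.update x p s :=
  continuous_id.update p continuous_const

/-- Averaging a function over the `p`-th coordinate does not change its integral. -/
lemma integral_cube_eq_integral_line {n : ℕ} (p : Fin n) {h : (Fin n → ℝ) → ℝ}
    (hh : Continuous h) :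
    ∫ x in cube n, h x = ∫ x in cube n, ∫ s in (0 : ℝ)..1, h (Function.update x p s) := by
  obtain _ | m := n
  · exact p.elim0
  set ν : Measure ℝ := volume.restrict (Set.Icc 0 1) with hν
  have : IsProbabilityMeasure ν := ⟨by simp [hν]⟩
  have hμ : (volume : Measure (Fin (m + 1) → ℝ)).restrict (cube (m + 1)) =
      Measure.pi fun _ => ν := by
    rw [cube, volume_pi, Measure.restrict_pi_pi]
  have hint : Integrable h (Measure.pi fun _ : Fin (m + 1) => ν) := by
    rw [← hμ]; exact integrableOn_cube hh
  have mp := (measurePreserving_piFinSuccAbove (fun _ : Fin (m + 1) => ν) p).symm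
  have key : ∀ f : (Fin (m + 1) → ℝ) → ℝ, ∫ x, f x ∂(Measure.pi fun _ => ν) =
      ∫ z, f (p.insertNth z.1 z.2) ∂(ν.prod (Measure.pi fun _ : Fin m => ν)) := fun f =>
    (mp.integral_comp' f).symm
  rw [hμ, key, key]
  have hint' : Integrable (fun z : ℝ × (Fin m → ℝ) => h (p.insertNth z.1 z.2))
      (ν.prod (Measure.pi fun _ : Fin m => ν)) :=
    (mp.integrable_comp_emb (MeasurableEquiv.measurableEmbedding _)).2 hint
  have hupd : ∀ z : ℝ × (Fin m → ℝ), ∫ s in (0 : ℝ)..1,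
      h (Function.update (p.insertNth z.1 z.2 : Fin (m + 1) → ℝ) p s) =
      ∫ s, h (p.insertNth s z.2) ∂ν := by
    intro z
    rw [intervalIntegral.integral_of_le zero_le_one, hν, integral_Icc_eq_integral_Ioc]
    simp
  simp only [hupd]
  rw [integral_prod_symm _ hint']
  rw [integral_fun_snd (fun y => ∫ s, h (p.insertNth s y) ∂ν)]
  simp

lemma hasDerivAt_update_line {n : ℕ} (p : Fin n) {u : (Fin n → ℝ) → ℝ}
    (hu : Differentiable ℝ u) (x : Fin n → ℝ) (s : ℝ) :
    HasDerivAt (fun s => u (Function.update x p s)) (pd p u (Function.update x p s)) s :=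
  (hu _).hasFDerivAt.comp_hasDerivAt s (hasDerivAt_update x p s)

lemma continuous_pd {n : ℕ} (p : Fin n) {u : (Fin n → ℝ) → ℝ} (hu : ContDiff ℝ 1 u) :
    Continuous (pd p u) :=
  (hu.continuous_fderiv one_ne_zero).clm_apply continuous_const

lemma continuous_pd_line {n : ℕ} (p : Fin n) {u : (Fin n → ℝ) → ℝ} (hu : ContDiff ℝ 1 u)
    (x : Fin n → ℝ) : Continuous fun s => pd p u (Function.update x p s) :=
  (continuous_pd p hu).comp ((continuous_update_pair p).comp (Continuous.prodMk_right x))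

lemma integral_cube_pd {n : ℕ} (p : Fin n) {u : (Fin n → ℝ) → ℝ} (hu : ContDiff ℝ 1 u) :
    ∫ x in cube n, pd p u x =
      ∫ x in cube n, (u (Function.update x p 1) - u (Function.update x p 0)) := by
  rw [integral_cube_eq_integral_line p (continuous_pd p hu)]
  congr 1 with x
  exact intervalIntegral.integral_eq_sub_of_hasDerivAt
    (fun s _ => hasDerivAt_update_line p (hu.differentiable one_ne_zero) x s)
    ((continuous_pd_line p hu x).intervalIntegrable _ _)

/-- Wirtinger's inequality on `[0,1]` for functions vanishing at `0`. -/
lemma wirtinger_interval {u u' : ℝ → ℝ} (hu : ∀ s, HasDerivAt u (u' s) s) (hu' : Continuous u')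
    (h0 : u 0 = 0) :
    (∫ s in (0 : ℝ)..1, u s ^ 2) ≤ 4 / π ^ 2 * ∫ s in (0 : ℝ)..1, u' s ^ 2 := by
  have hc : Continuous u := continuous_iff_continuousAt.2 fun s => (hu s).continuousAt
  have key : ∀ a ∈ Set.Ioo 0 (π / 2),
      a ^ 2 * (∫ s in (0 : ℝ)..1, u s ^ 2) ≤ ∫ s in (0 : ℝ)..1, u' s ^ 2 := by
    intro a ha
    have hcos : ∀ s ∈ Set.Icc (0 : ℝ) 1, 0 < cos (a * (1 - s)) := by
      intro s hs
      apply cos_pos_of_mem_Ioo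
      constructor <;> nlinarith [ha.1, ha.2, hs.1, hs.2, pi_pos]
    set G : ℝ → ℝ := fun s => a * tan (a * (1 - s)) * u s ^ 2 with hG
    set G' : ℝ → ℝ := fun s => a * (1 / cos (a * (1 - s)) ^ 2 * (a * (-1))) * u s ^ 2 +
      a * tan (a * (1 - s)) * (2 * u s * u' s) with hG'
    have hd : ∀ s ∈ Set.Icc (0 : ℝ) 1, HasDerivAt G (G' s) s := by
      intro s hs
      have h1 : HasDerivAt (fun s => a * (1 - s)) (a * (-1)) s :=
        ((hasDerivAt_id s).const_sub 1).const_mul a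
      have h2 := ((hasDerivAt_tan (hcos s hs).ne').comp s h1).const_mul a
      have h3 := (hu s).pow 2
      refine (h2.mul h3).congr_deriv ?_
      simp [hG']
    have hcont : ContinuousOn G' (Set.Icc 0 1) := by
      have h1 : Continuous fun s : ℝ => a * (1 - s) := by fun_prop
      have ht : ContinuousOn (fun s : ℝ => tan (a * (1 - s))) (Set.Icc 0 1) := by
        simp only [tan_eq_sin_div_cos]
        exact ((continuous_sin.comp h1).continuousOn).div ((continuous_cos.comp h1).continuousOn)
          fun s hs => (hcos s hs).ne'
      have hi : ContinuousOn (fun s : ℝ => 1 / cos (a * (1 - s)) ^ 2) (Set.Icc 0 1) :=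
        continuousOn_const.div ((continuous_cos.comp h1).pow 2).continuousOn
          fun s hs => (pow_pos (hcos s hs) 2).ne'
      have := hc.continuousOn (s := Set.Icc (0 : ℝ) 1)
      have := hu'.continuousOn (s := Set.Icc (0 : ℝ) 1)
      fun_prop
    have hG'i : IntervalIntegrable G' volume 0 1 := by
      apply ContinuousOn.intervalIntegrable
      rwa [Set.uIcc_of_le zero_le_one]
    have hsub : ∫ s in (0 : ℝ)..1, G' s = 0 := by
      have hd' : ∀ s ∈ Set.uIcc (0 : ℝ) 1, HasDerivAt G (G' s) s := by
        rwa [Set.uIcc_of_le zero_le_one]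
      rw [intervalIntegral.integral_eq_sub_of_hasDerivAt hd' hG'i]
      simp [hG, h0]
    have hle : (∫ s in (0 : ℝ)..1, (a ^ 2 * u s ^ 2 + G' s)) ≤ ∫ s in (0 : ℝ)..1, u' s ^ 2 := by
      apply intervalIntegral.integral_mono_on zero_le_one
      · exact (Continuous.intervalIntegrable (by fun_prop) _ _).add hG'i
      · exact Continuous.intervalIntegrable (by fun_prop) _ _
      · intro s hs
        have hp := hcos s hs
        have h1 : 1 / cos (a * (1 - s)) ^ 2 = 1 + tan (a * (1 - s)) ^ 2 := by
          rw [tan_eq_sin_div_cos]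
          field_simp
          nlinarith [sin_sq_add_cos_sq (a * (1 - s))]
        simp only [hG', h1]
        nlinarith [sq_nonneg (u' s - a * tan (a * (1 - s)) * u s)]
    rw [intervalIntegral.integral_add (Continuous.intervalIntegrable (by fun_prop) _ _) hG'i,
      hsub, intervalIntegral.integral_const_mul] at hle
    linarith
  have hlim : (π / 2) ^ 2 * (∫ s in (0 : ℝ)..1, u s ^ 2) ≤ ∫ s in (0 : ℝ)..1, u' s ^ 2 := by
    have hp : 0 < π / 2 := by positivity
    have ht : Filter.Tendsto (fun a : ℝ => a ^ 2 * ∫ s in (0 : ℝ)..1, u s ^ 2)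
        (nhdsWithin (π / 2) (Set.Iio (π / 2))) (nhds ((π / 2) ^ 2 * ∫ s in (0 : ℝ)..1, u s ^ 2)) :=
      (Continuous.tendsto (by fun_prop) _).mono_left nhdsWithin_le_nhds
    exact le_of_tendsto ht (Filter.eventually_of_mem (Ioo_mem_nhdsLT hp) key)
  have h4 : 4 / π ^ 2 * ((π / 2) ^ 2 * ∫ s in (0 : ℝ)..1, u s ^ 2) =
      ∫ s in (0 : ℝ)..1, u s ^ 2 := by
    field_simp
    norm_num
  rw [← h4]
  exact mul_le_mul_of_nonneg_left hlim (by positivity)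

lemma sq_le_integral_deriv_sq {u u' : ℝ → ℝ} (hu : ∀ s, HasDerivAt u (u' s) s)
    (hu' : Continuous u') (h0 : u 0 = 0) : u 1 ^ 2 ≤ ∫ s in (0 : ℝ)..1, u' s ^ 2 := by
  have h1 : ∫ s in (0 : ℝ)..1, u' s = u 1 := by
    rw [intervalIntegral.integral_eq_sub_of_hasDerivAt (fun s _ => hu s)
      (hu'.intervalIntegrable _ _), h0, sub_zero]
  have h2 : (∫ s in (0 : ℝ)..1, (2 * u 1 * u' s - u 1 ^ 2)) ≤ ∫ s in (0 : ℝ)..1, u' s ^ 2 := by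
    apply intervalIntegral.integral_mono_on zero_le_one
    · exact Continuous.intervalIntegrable (by fun_prop) _ _
    · exact Continuous.intervalIntegrable (by fun_prop) _ _
    · intro s _
      nlinarith [sq_nonneg (u' s - u 1)]
  rw [intervalIntegral.integral_sub (Continuous.intervalIntegrable (by fun_prop) _ _)
    (Continuous.intervalIntegrable (by fun_prop) _ _), intervalIntegral.integral_const_mul, h1,
    intervalIntegral.integral_const] at h2
  simp only [sub_zero, one_smul] at h2
  linarith

lemma continuous_integral_line {n : ℕ} (p : Fin n) {h : (Fin n → ℝ) → ℝ} (hh : Continuous h) :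
    Continuous fun x => ∫ s in (0 : ℝ)..1, h (Function.update x p s) :=
  intervalIntegral.continuous_parametric_intervalIntegral_of_continuous'
    (f := fun x s => h (Function.update x p s)) (hh.comp (continuous_update_pair p)) 0 1

lemma wirtinger_cube_coord {n : ℕ} (p : Fin n) {u : (Fin n → ℝ) → ℝ} (hu : ContDiff ℝ 1 u)
    (h0 : ∀ x ∈ cube n, x p = 0 → u x = 0) :
    (∫ x in cube n, u x ^ 2) ≤ 4 / π ^ 2 * ∫ x in cube n, pd p u x ^ 2 := by
  have hc : Continuous fun x => u x ^ 2 := hu.continuous.pow 2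
  have hp : Continuous fun x => pd p u x ^ 2 := (continuous_pd p hu).pow 2
  rw [integral_cube_eq_integral_line p hc, integral_cube_eq_integral_line p hp,
    ← integral_const_mul]
  refine integral_cube_mono (continuous_integral_line p hc)
    (continuous_const.mul (continuous_integral_line p hp)) fun x hx => ?_
  exact wirtinger_interval (hasDerivAt_update_line p (hu.differentiable one_ne_zero) x)
    (continuous_pd_line p hu x) (h0 _ (update_mem_cube hx p (by simp)) (by simp))

lemma trace_cube_coord {n : ℕ} (p : Fin n) {u : (Fin n → ℝ) → ℝ} (hu : ContDiff ℝ 1 u)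
    (h0 : ∀ x ∈ cube n, x p = 0 → u x = 0) :
    (∫ x in cube n, u (Function.update x p 1) ^ 2) ≤ ∫ x in cube n, pd p u x ^ 2 := by
  have hc : Continuous fun x => u x ^ 2 := hu.continuous.pow 2
  have hp : Continuous fun x => pd p u x ^ 2 := (continuous_pd p hu).pow 2
  rw [integral_cube_eq_integral_line p hp]
  refine integral_cube_mono (hc.comp (continuous_update_left p 1))
    (continuous_integral_line p hp) fun x hx => ?_
  exact sq_le_integral_deriv_sq (hasDerivAt_update_line p (hu.differentiable one_ne_zero) x)
    (continuous_pd_line p hu x) (h0 _ (update_mem_cube hx p (by simp)) (by simp))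

lemma integral_gradSq {n : ℕ} {u : (Fin n → ℝ) → ℝ} (hu : ContDiff ℝ 1 u) :
    ∫ x in cube n, gradSq u x = ∑ p, ∫ x in cube n, pd p u x ^ 2 :=
  integral_finsetSum _ fun p _ => integrableOn_cube ((continuous_pd p hu).pow 2)

lemma wirtinger_cube {n : ℕ} (hn : 1 ≤ n) {u : (Fin n → ℝ) → ℝ} (hu : ContDiff ℝ 1 u)
    (h0 : ∀ x ∈ cube n, (∃ p, x p = 0) → u x = 0) :
    (∫ x in cube n, u x ^ 2) ≤ 4 / (π ^ 2 * n) * ∫ x in cube n, gradSq u x := by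
  have hn' : (0 : ℝ) < n := by exact_mod_cast hn
  have h := Finset.sum_le_sum fun p (_ : p ∈ Finset.univ) =>
    wirtinger_cube_coord p hu fun x hx hp => h0 x hx ⟨p, hp⟩
  rw [← Finset.mul_sum, ← integral_gradSq hu, Finset.sum_const, Finset.card_univ,
    Fintype.card_fin, nsmul_eq_mul] at h
  calc (∫ x in cube n, u x ^ 2) = (n * ∫ x in cube n, u x ^ 2) / n := by field_simp
    _ ≤ (4 / π ^ 2 * ∫ x in cube n, gradSq u x) / n := by gcongr
    _ = _ := by field_simp

lemma faceInt_sq_le {n : ℕ} {u : (Fin n → ℝ) → ℝ} (hu : ContDiff ℝ 1 u)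
    (h0 : ∀ x ∈ cube n, (∃ p, x p = 0) → u x = 0) :
    faceInt (fun x => u x ^ 2) ≤ ∫ x in cube n, gradSq u x := by
  rw [integral_gradSq hu]
  exact Finset.sum_le_sum fun p _ => trace_cube_coord p hu fun x hx hp => h0 x hx ⟨p, hp⟩

lemma faceInt_nonneg {n : ℕ} {h : (Fin n → ℝ) → ℝ} (hh : ∀ x, 0 ≤ h x) : 0 ≤ faceInt h :=
  Finset.sum_nonneg fun _ _ => integral_nonneg fun _ => hh _

lemma isCompact_unitSphere_sum : IsCompact {v : Fin 3 → ℝ | (∑ i, (v i) ^ 2) = 1} := by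
  refine (isCompact_Icc (a := (-1 : Fin 3 → ℝ)) (b := 1)).of_isClosed_subset
    (isClosed_eq (by fun_prop) continuous_const) fun v hv => ?_
  have h : ∀ i, |v i| ≤ 1 := fun i => by
    rw [← sq_le_one_iff_abs_le_one]
    exact (Finset.single_le_sum (f := fun i => v i ^ 2) (fun j _ => sq_nonneg (v j))
      (Finset.mem_univ i)).trans hv.le
  exact ⟨fun i => (abs_le.1 (h i)).1, fun i => (abs_le.1 (h i)).2⟩

lemma rayleigh_set_eq_image (M : Matrix (Fin 3) (Fin 3) ℝ) :
    {r | ∃ v : Fin 3 → ℝ, (∑ i, (v i) ^ 2) = 1 ∧ r = v ⬝ᵥ M.mulVec v} =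
      (fun v => v ⬝ᵥ M.mulVec v) '' {v : Fin 3 → ℝ | (∑ i, (v i) ^ 2) = 1} := by
  ext r
  simp [eq_comm]

lemma isCompact_rayleigh_set (M : Matrix (Fin 3) (Fin 3) ℝ) :
    IsCompact {r | ∃ v : Fin 3 → ℝ, (∑ i, (v i) ^ 2) = 1 ∧ r = v ⬝ᵥ M.mulVec v} := by
  rw [rayleigh_set_eq_image]
  refine isCompact_unitSphere_sum.image ?_
  simp only [dotProduct, Matrix.mulVec]
  fun_prop

lemma exists_normalized (v : Fin 3 → ℝ) (hv : 0 < ∑ i, (v i) ^ 2)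
    (M : Matrix (Fin 3) (Fin 3) ℝ) : ∃ w : Fin 3 → ℝ, (∑ i, (w i) ^ 2) = 1 ∧
      v ⬝ᵥ M.mulVec v = (∑ i, (v i) ^ 2) * (w ⬝ᵥ M.mulVec w) := by
  set N := ∑ i, (v i) ^ 2 with hN
  have hs : √N ^ 2 = N := sq_sqrt hv.le
  have hs0 : √N ≠ 0 := (sqrt_pos.2 hv).ne'
  refine ⟨(√N)⁻¹ • v, ?_, ?_⟩
  · simp only [Pi.smul_apply, smul_eq_mul, mul_pow, ← Finset.mul_sum, ← hN]
    rw [inv_pow, hs, inv_mul_cancel₀ hv.ne']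
  · rw [Matrix.mulVec_smul, smul_dotProduct, dotProduct_smul, smul_eq_mul, smul_eq_mul]
    nth_rw 1 [← hs]
    field_simp

lemma lamMin_mul_le (M : Matrix (Fin 3) (Fin 3) ℝ) (v : Fin 3 → ℝ) :
    lamMin M * ∑ i, (v i) ^ 2 ≤ v ⬝ᵥ M.mulVec v := by
  rcases (Finset.sum_nonneg fun i (_ : i ∈ Finset.univ) => sq_nonneg (v i)).eq_or_lt' with h | h
  · have hv : v = 0 := by
      ext i
      have := (Finset.sum_eq_zero_iff_of_nonneg fun i _ => sq_nonneg (v i)).1 h i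
        (Finset.mem_univ i)
      simpa using this
    simp [hv]
  · obtain ⟨w, hw, he⟩ := exists_normalized v h M
    rw [he, mul_comm]
    exact mul_le_mul_of_nonneg_left
      (csInf_le (isCompact_rayleigh_set M).bddBelow ⟨w, hw, rfl⟩) h.le

lemma le_lamMax_mul (M : Matrix (Fin 3) (Fin 3) ℝ) (v : Fin 3 → ℝ) :
    v ⬝ᵥ M.mulVec v ≤ lamMax M * ∑ i, (v i) ^ 2 := by
  rcases (Finset.sum_nonneg fun i (_ : i ∈ Finset.univ) => sq_nonneg (v i)).eq_or_lt' with h | h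
  · have hv : v = 0 := by
      ext i
      have := (Finset.sum_eq_zero_iff_of_nonneg fun i _ => sq_nonneg (v i)).1 h i
        (Finset.mem_univ i)
      simpa using this
    simp [hv]
  · obtain ⟨w, hw, he⟩ := exists_normalized v h M
    rw [he, mul_comm]
    exact mul_le_mul_of_nonneg_right
      (le_csSup (isCompact_rayleigh_set M).bddAbove ⟨w, hw, rfl⟩) h.le

lemma lamMin_pos {M : Matrix (Fin 3) (Fin 3) ℝ} (hM : M.PosDef) : 0 < lamMin M := by
  have hne : {r | ∃ v : Fin 3 → ℝ, (∑ i, (v i) ^ 2) = 1 ∧ r = v ⬝ᵥ M.mulVec v}.Nonempty :=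
    ⟨_, ![1, 0, 0], by simp [Fin.sum_univ_three], rfl⟩
  obtain ⟨v, hv, he⟩ := (isCompact_rayleigh_set M).sInf_mem hne
  rw [lamMin, he]
  have hv0 : v ≠ 0 := by
    rintro rfl
    simp at hv
  simpa using hM.dotProduct_mulVec_pos hv0

lemma lamMin_Phi0_mul_le (n : ℕ) (χ lam0 a b c : ℝ) :
    lamMin (Phi0 n χ lam0) * (a ^ 2 + b ^ 2 + c ^ 2) ≤
      (1 / 2 - 4 * lam0 / (π ^ 2 * n)) * a ^ 2 + 1 / 2 * b ^ 2 + lam0 * c ^ 2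
        - 2 * √n * χ * (a * b) - (n - 1) * χ * (b * c) := by
  have hform : ![a, -b, c] ⬝ᵥ (Phi0 n χ lam0).mulVec ![a, -b, c] =
      (1 / 2 - 4 * lam0 / (π ^ 2 * n)) * a ^ 2 + 1 / 2 * b ^ 2 + lam0 * c ^ 2
        - 2 * √n * χ * (a * b) - (n - 1) * χ * (b * c) := by
    simp [Phi0, dotProduct, Matrix.mulVec, Fin.sum_univ_three]
    ring
  have h := lamMin_mul_le (Phi0 n χ lam0) ![a, -b, c]
  rw [hform] at h
  simpa [Fin.sum_univ_three] using h

lemma le_lamMax_Phi1_mul (n : ℕ) (χ lam0 a b c : ℝ) :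
    1 / 2 * a ^ 2 + 1 / 2 * b ^ 2 + lam0 * c ^ 2 + 2 * √n * χ * (a * b) + (n - 1) * χ * (b * c) ≤
      lamMax (Phi1 n χ lam0) * (a ^ 2 + b ^ 2 + c ^ 2) := by
  have hform : ![a, b, c] ⬝ᵥ (Phi1 n χ lam0).mulVec ![a, b, c] =
      1 / 2 * a ^ 2 + 1 / 2 * b ^ 2 + lam0 * c ^ 2 + 2 * √n * χ * (a * b)
        + (n - 1) * χ * (b * c) := by
    simp [Phi1, Phi0, dotProduct, Matrix.mulVec, Fin.sum_univ_three]
    ring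
  have h := le_lamMax_mul (Phi1 n χ lam0) ![a, b, c]
  rw [hform] at h
  simpa [Fin.sum_univ_three] using h

lemma lamMax_Phi1_nonneg (n : ℕ) (χ lam0 : ℝ) : 0 ≤ lamMax (Phi1 n χ lam0) := by
  have h := le_lamMax_Phi1_mul n χ lam0 0 1 0
  norm_num at h
  linarith

lemma Psi2_form_nonpos {n : ℕ} {k χ δ g1 lam1 : ℝ} (h : NegSemidefM (Psi2 n k χ δ g1 lam1))
    (a b c : ℝ) :
    (-χ + δ * (1 + χ * k * (n - 1)) + 4 * lam1 / (π ^ 2 * n)) * a ^ 2 + (-χ + δ) * b ^ 2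
      + (-lam1 + g1 * (n - 1) * χ) * c ^ 2 + 4 * δ * √n * χ * (a * b)
      + 2 * √n * g1 * χ * (a * c) + (g1 + 2 * δ * (n - 1) * χ) * (b * c) ≤ 0 := by
  have h := Matrix.PosSemidef.dotProduct_mulVec_nonneg h ![a, b, c]
  simp [Psi2, dotProduct, Matrix.mulVec, Fin.sum_univ_three] at h
  linarith

lemma PhiM_form_nonpos {n : ℕ} {χ σ lam2 : ℝ} (h : NegDefM (PhiM n χ σ lam2)) (a b c : ℝ) :
    (-(1 - σ) / 2 + 4 * lam2 / (π ^ 2 * n)) * a ^ 2 - (1 - σ) / 2 * b ^ 2 - lam2 * c ^ 2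
      + 2 * √n * (1 + σ) * χ * (a * b) + (n - 1) * (1 + σ) * χ * (b * c) ≤ 0 := by
  have h := (Matrix.PosDef.posSemidef h).dotProduct_mulVec_nonneg ![a, b, c]
  simp [PhiM, dotProduct, Matrix.mulVec, Fin.sum_univ_three] at h
  linarith

lemma gradSq_nonneg {n : ℕ} (u : (Fin n → ℝ) → ℝ) (x : Fin n → ℝ) : 0 ≤ gradSq u x :=
  Finset.sum_nonneg fun _ _ => sq_nonneg _

lemma sum_sq_le_of_mem_cube {n : ℕ} {x : Fin n → ℝ} (hx : x ∈ cube n) : ∑ p, x p ^ 2 ≤ n := by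
  calc ∑ p, x p ^ 2 ≤ ∑ _p : Fin n, (1 : ℝ) :=
        Finset.sum_le_sum fun p _ => pow_le_one₀ (hx p trivial).1 (hx p trivial).2
    _ = n := by simp

lemma abs_xGrad_le {n : ℕ} (u : (Fin n → ℝ) → ℝ) {x : Fin n → ℝ} (hx : x ∈ cube n) :
    |xGrad u x| ≤ √n * √(gradSq u x) := by
  rw [← sqrt_mul (Nat.cast_nonneg n)]
  apply abs_le_sqrt
  calc xGrad u x ^ 2 ≤ (∑ p, x p ^ 2) * ∑ p, pd p u x ^ 2 := Finset.sum_mul_sq_le_sq_mul_sq _ _ _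
    _ ≤ n * gradSq u x :=
        mul_le_mul_of_nonneg_right (sum_sq_le_of_mem_cube hx) (gradSq_nonneg u x)

lemma continuous_gradSq {n : ℕ} {u : (Fin n → ℝ) → ℝ} (hu : ContDiff ℝ 1 u) :
    Continuous (gradSq u) :=
  continuous_finsetSum _ fun p _ => (continuous_pd p hu).pow 2

lemma continuous_xGrad {n : ℕ} {u : (Fin n → ℝ) → ℝ} (hu : ContDiff ℝ 1 u) :
    Continuous (xGrad u) :=
  continuous_finsetSum _ fun p _ => (continuous_apply p).mul (continuous_pd p hu)

lemma integral_cube_add {n : ℕ} {f g : (Fin n → ℝ) → ℝ} (hf : Continuous f) (hg : Continuous g) :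
    ∫ x in cube n, (f x + g x) = (∫ x in cube n, f x) + ∫ x in cube n, g x :=
  integral_add (integrableOn_cube hf) (integrableOn_cube hg)

lemma integral_cube_sub {n : ℕ} {f g : (Fin n → ℝ) → ℝ} (hf : Continuous f) (hg : Continuous g) :
    ∫ x in cube n, (f x - g x) = (∫ x in cube n, f x) - ∫ x in cube n, g x :=
  integral_sub (integrableOn_cube hf) (integrableOn_cube hg)

/-- Density of the multiplier term `(2 xᵀ∇u + (n-1) u) v`. -/
def crossDensity {n : ℕ} (u v : (Fin n → ℝ) → ℝ) (x : Fin n → ℝ) : ℝ :=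
  (2 * xGrad u x + ((n : ℝ) - 1) * u x) * v x

lemma continuous_crossDensity {n : ℕ} {u v : (Fin n → ℝ) → ℝ} (hu : ContDiff ℝ 1 u)
    (hv : Continuous v) : Continuous (crossDensity u v) :=
  (((continuous_xGrad hu).const_mul 2).add (hu.continuous.const_mul _)).mul hv

lemma abs_crossDensity_le {n : ℕ} (hn : 1 ≤ n) (u v : (Fin n → ℝ) → ℝ) {x : Fin n → ℝ}
    (hx : x ∈ cube n) : |crossDensity u v x| ≤
      2 * √n * (√(gradSq u x) * |v x|) + (n - 1) * (|v x| * |u x|) := by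
  have hn' : (0 : ℝ) ≤ n - 1 := sub_nonneg.2 (by exact_mod_cast hn)
  rw [crossDensity, abs_mul]
  have h1 : |2 * xGrad u x + ((n : ℝ) - 1) * u x| ≤
      2 * (√n * √(gradSq u x)) + (n - 1) * |u x| := by
    refine (abs_add_le _ _).trans ?_
    rw [abs_mul, abs_mul, abs_two, abs_of_nonneg hn']
    gcongr
    exact abs_xGrad_le u hx
  calc _ ≤ (2 * (√n * √(gradSq u x)) + (n - 1) * |u x|) * |v x| :=
        mul_le_mul_of_nonneg_right h1 (abs_nonneg _)
    _ = _ := by ring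

/-- Lyapunov functional of the wave equation with boundary damping. -/
def lyap {n : ℕ} (k χ : ℝ) (u v : (Fin n → ℝ) → ℝ) : ℝ :=
  (∫ x in cube n, (1 / 2 * (gradSq u x + v x ^ 2) + χ * crossDensity u v x)) +
    χ * k * (n - 1) / 2 * faceInt fun x => u x ^ 2

lemma lyap_eq {n : ℕ} (k χ : ℝ) {u v : (Fin n → ℝ) → ℝ} (hu : ContDiff ℝ 1 u)
    (hv : Continuous v) : lyap k χ u v =
      1 / 2 * (∫ x in cube n, (gradSq u x + v x ^ 2)) + χ * (∫ x in cube n, crossDensity u v x) +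
        χ * k * (n - 1) / 2 * faceInt fun x => u x ^ 2 := by
  have hG := continuous_gradSq hu
  have hJ := continuous_crossDensity hu hv
  rw [lyap, integral_cube_add (by fun_prop) (by fun_prop), integral_const_mul, integral_const_mul]

section

variable {n : ℕ} {u v : (Fin n → ℝ) → ℝ}

lemma lamMin_mul_integral_le_lyap (hn : 1 ≤ n) {k χ lam0 : ℝ} (hk : 0 < k) (hχ : 0 < χ)
    (hl0 : 0 < lam0) (hΦ0 : (Phi0 n χ lam0).PosDef) (hu : ContDiff ℝ 1 u) (hv : Continuous v)
    (h0 : ∀ x ∈ cube n, (∃ p, x p = 0) → u x = 0) :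
    lamMin (Phi0 n χ lam0) * (∫ x in cube n, (gradSq u x + v x ^ 2)) ≤ lyap k χ u v := by
  have hn' : (0 : ℝ) ≤ n - 1 := sub_nonneg.2 (by exact_mod_cast hn)
  have hG := continuous_gradSq hu
  have hJ := continuous_crossDensity hu hv
  have hc := hu.continuous
  have hW := wirtinger_cube hn hu h0
  have hB : 0 ≤ χ * k * (n - 1) / 2 * faceInt fun x => u x ^ 2 :=
    mul_nonneg (by positivity) (faceInt_nonneg fun x => sq_nonneg _)
  have h : (∫ x in cube n, lamMin (Phi0 n χ lam0) * (gradSq u x + v x ^ 2)) ≤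
      ∫ x in cube n, ((1 / 2 * (gradSq u x + v x ^ 2) + χ * crossDensity u v x) +
        lam0 * (u x ^ 2 - 4 / (π ^ 2 * n) * gradSq u x)) := by
    refine integral_cube_mono (by fun_prop) (by fun_prop) fun x hx => ?_
    have h1 := lamMin_Phi0_mul_le n χ lam0 (√(gradSq u x)) |v x| |u x|
    have h2 := mul_le_mul_of_nonneg_left
      ((neg_le_abs _).trans (abs_crossDensity_le hn u v hx)) hχ.le
    rw [sq_sqrt (gradSq_nonneg u x), sq_abs, sq_abs] at h1
    have h3 : 4 * lam0 / (π ^ 2 * n) = lam0 * (4 / (π ^ 2 * n)) := by ring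
    rw [h3] at h1
    have h4 := mul_nonneg (lamMin_pos hΦ0).le (sq_nonneg (u x))
    linarith
  rw [integral_const_mul,
    integral_cube_add (g := fun x => lam0 * (u x ^ 2 - 4 / (π ^ 2 * n) * gradSq u x))
      (by fun_prop) (by fun_prop), integral_const_mul lam0,
    integral_cube_sub (by fun_prop) (by fun_prop), integral_const_mul] at h
  have h5 := mul_nonneg hl0.le (sub_nonneg.2 hW)
  rw [lyap]
  linarith

lemma lyap_le (hn : 1 ≤ n) {k χ lam0 : ℝ} (hk : 0 < k) (hχ : 0 < χ)
    (hl0 : 0 < lam0) (hu : ContDiff ℝ 1 u) (hv : Continuous v)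
    (h0 : ∀ x ∈ cube n, (∃ p, x p = 0) → u x = 0) :
    lyap k χ u v ≤ betaC n k χ lam0 / 2 * ∫ x in cube n, (gradSq u x + v x ^ 2) := by
  have hn' : (0 : ℝ) ≤ n - 1 := sub_nonneg.2 (by exact_mod_cast hn)
  have hG := continuous_gradSq hu
  have hJ := continuous_crossDensity hu hv
  have hc := hu.continuous
  have hL := lamMax_Phi1_nonneg n χ lam0
  have hW := mul_le_mul_of_nonneg_left (wirtinger_cube hn hu h0) hL
  have hB := mul_le_mul_of_nonneg_left (faceInt_sq_le hu h0)
    (show 0 ≤ χ * k * (n - 1) / 2 by positivity)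
  have h : (∫ x in cube n, (1 / 2 * (gradSq u x + v x ^ 2) + χ * crossDensity u v x)) ≤
      ∫ x in cube n, lamMax (Phi1 n χ lam0) * ((gradSq u x + v x ^ 2) + u x ^ 2) := by
    refine integral_cube_mono (by fun_prop) (by fun_prop) fun x hx => ?_
    have h1 := le_lamMax_Phi1_mul n χ lam0 (√(gradSq u x)) |v x| |u x|
    have h2 := mul_le_mul_of_nonneg_left
      ((le_abs_self _).trans (abs_crossDensity_le hn u v hx)) hχ.le
    rw [sq_sqrt (gradSq_nonneg u x), sq_abs, sq_abs] at h1
    have h4 := mul_nonneg hl0.le (sq_nonneg (u x))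
    linarith
  have hle : (∫ x in cube n, gradSq u x) ≤ ∫ x in cube n, (gradSq u x + v x ^ 2) :=
    integral_cube_mono (by fun_prop) (by fun_prop) fun x _ => by nlinarith [sq_nonneg (v x)]
  rw [integral_const_mul, integral_cube_add (f := fun x => gradSq u x + v x ^ 2)
    (by fun_prop) (by fun_prop)] at h
  have h6 : (0 : ℝ) ≤ lamMax (Phi1 n χ lam0) * (4 / (π ^ 2 * n)) + χ * k * (n - 1) / 2 := by
    positivity
  have h7 := mul_le_mul_of_nonneg_left hle h6
  rw [lyap, betaC]
  linarith

lemma mul_lyap_le_lyap_neg (hn : 1 ≤ n) {k χ σ lam2 : ℝ} (hk : 0 < k) (hχ : 0 < χ)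
    (hl2 : 0 < lam2) (hσ0 : 0 < σ) (hσ1 : σ ≤ 1) (hΦ : NegDefM (PhiM n χ σ lam2))
    (hu : ContDiff ℝ 1 u) (hv : Continuous v)
    (h0 : ∀ x ∈ cube n, (∃ p, x p = 0) → u x = 0) :
    σ * lyap k χ u v ≤ lyap k χ u fun x => -v x := by
  have hn' : (0 : ℝ) ≤ n - 1 := sub_nonneg.2 (by exact_mod_cast hn)
  have hG := continuous_gradSq hu
  have hJ := continuous_crossDensity hu hv
  have hc := hu.continuous
  have hW := mul_le_mul_of_nonneg_left (wirtinger_cube hn hu h0) hl2.le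
  have hB : 0 ≤ (1 - σ) * (χ * k * (n - 1) / 2 * faceInt fun x => u x ^ 2) :=
    mul_nonneg (sub_nonneg.2 hσ1) (mul_nonneg (by positivity) (faceInt_nonneg fun x => sq_nonneg _))
  have h : (∫ x in cube n, (1 + σ) * (χ * crossDensity u v x)) ≤
      ∫ x in cube n, ((1 - σ) / 2 * (gradSq u x + v x ^ 2) +
        lam2 * (u x ^ 2 - 4 / (π ^ 2 * n) * gradSq u x)) := by
    refine integral_cube_mono (by fun_prop) (by fun_prop) fun x hx => ?_
    have h1 := PhiM_form_nonpos hΦ (√(gradSq u x)) |v x| |u x|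
    have h2 := mul_le_mul_of_nonneg_left
      ((le_abs_self _).trans (abs_crossDensity_le hn u v hx))
      (show 0 ≤ (1 + σ) * χ by positivity)
    rw [sq_sqrt (gradSq_nonneg u x), sq_abs, sq_abs] at h1
    have h3 : 4 * lam2 / (π ^ 2 * n) = lam2 * (4 / (π ^ 2 * n)) := by ring
    rw [h3] at h1
    linarith
  rw [integral_const_mul, integral_const_mul, integral_cube_add (by fun_prop) (by fun_prop),
    integral_const_mul, integral_const_mul, integral_cube_sub (by fun_prop) (by fun_prop),
    integral_const_mul] at h
  have hneg : ∀ x, crossDensity u (fun x => -v x) x = -crossDensity u v x := fun x => by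
    simp [crossDensity]
  rw [lyap_eq k χ hu hv, lyap_eq k χ hu (show Continuous fun x => -v x by fun_prop)]
  simp only [hneg, integral_neg, neg_sq]
  linarith

/-- The volume terms left in the time derivative of the Lyapunov functional are dominated by
`-2δ` times the functional. -/
lemma integral_add_two_mul_lyap_nonpos (hn : 1 ≤ n) {k χ δ g1 lam1 : ℝ} (hk : 0 < k) (hχ : 0 < χ)
    (hδ : 0 < δ) (hl1 : 0 < lam1) (hΨ2 : NegSemidefM (Psi2 n k χ δ g1 lam1))
    (hu : ContDiff ℝ 1 u) (hv : Continuous v) {f : (Fin n → ℝ) → ℝ} (hf : Continuous f)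
    (h0 : ∀ x ∈ cube n, (∃ p, x p = 0) → u x = 0)
    (hfu : ∀ x ∈ cube n, |f x| ≤ g1 * |u x|) :
    (∫ x in cube n, (v x * f x + χ * crossDensity u f x - χ * (gradSq u x + v x ^ 2))) +
      2 * δ * lyap k χ u v ≤ 0 := by
  have hn' : (0 : ℝ) ≤ n - 1 := sub_nonneg.2 (by exact_mod_cast hn)
  have hG := continuous_gradSq hu
  have hJ := continuous_crossDensity hu hv
  have hJf := continuous_crossDensity hu hf
  have hc := hu.continuous
  have hW := mul_le_mul_of_nonneg_left (wirtinger_cube hn hu h0) hl1.le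
  have hB := mul_le_mul_of_nonneg_left (faceInt_sq_le hu h0)
    (show 0 ≤ δ * (χ * k * (n - 1)) by positivity)
  have h : (∫ x in cube n,
      ((v x * f x + χ * crossDensity u f x - χ * (gradSq u x + v x ^ 2)) +
        2 * δ * (1 / 2 * (gradSq u x + v x ^ 2) + χ * crossDensity u v x))) ≤
      ∫ x in cube n, (lam1 * (u x ^ 2 - 4 / (π ^ 2 * n) * gradSq u x) -
        δ * (χ * k * (n - 1)) * gradSq u x) := by
    refine integral_cube_mono (by fun_prop) (by fun_prop) fun x hx => ?_
    have h1 := Psi2_form_nonpos hΨ2 (√(gradSq u x)) |v x| |u x|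
    have h2 := mul_le_mul_of_nonneg_left
      ((le_abs_self _).trans (abs_crossDensity_le hn u v hx))
      (show 0 ≤ 2 * δ * χ by positivity)
    have h5 := mul_le_mul_of_nonneg_left
      ((le_abs_self _).trans (abs_crossDensity_le hn u f hx)) hχ.le
    have h6 : v x * f x ≤ |v x| * (g1 * |u x|) :=
      (le_abs_self _).trans (by rw [abs_mul]; gcongr; exact hfu x hx)
    have h7 : χ * (2 * √n * (√(gradSq u x) * |f x|) + (n - 1) * (|f x| * |u x|)) ≤
        χ * (2 * √n * (√(gradSq u x) * (g1 * |u x|)) + (n - 1) * (g1 * |u x| * |u x|)) := by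
      gcongr <;> exact hfu x hx
    have h8 : |u x| * |u x| = u x ^ 2 := by rw [← sq, sq_abs]
    rw [mul_assoc g1, h8] at h7
    rw [sq_sqrt (gradSq_nonneg u x), sq_abs, sq_abs] at h1
    have h3 : 4 * lam1 / (π ^ 2 * n) = lam1 * (4 / (π ^ 2 * n)) := by ring
    rw [h3] at h1
    linarith
  rw [integral_cube_add (by fun_prop) (by fun_prop), integral_const_mul,
    integral_cube_sub (f := fun x => lam1 * (u x ^ 2 - 4 / (π ^ 2 * n) * gradSq u x))
      (by fun_prop) (by fun_prop), integral_const_mul lam1,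
    integral_cube_sub (f := fun x => u x ^ 2) (by fun_prop) (by fun_prop),
    integral_const_mul, integral_const_mul] at h
  rw [lyap]
  linarith

end

/-- Time derivative of a function on space-time. -/
def dt {n : ℕ} (E : ℝ × (Fin n → ℝ) → ℝ) (z : ℝ × (Fin n → ℝ)) : ℝ :=
  fderiv ℝ E z (1, 0)

/-- Partial derivative in the `p`-th space direction of a function on space-time. -/
def dx {n : ℕ} (p : Fin n) (E : ℝ × (Fin n → ℝ) → ℝ) (z : ℝ × (Fin n → ℝ)) : ℝ :=
  fderiv ℝ E z (0, Pi.single p 1)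

section

variable {n : ℕ} {E : ℝ × (Fin n → ℝ) → ℝ}

lemma contDiff_dt (hE : ContDiff ℝ 2 E) : ContDiff ℝ 1 (dt E) :=
  (hE.fderiv_right (m := 1) (by norm_num)).clm_apply contDiff_const

lemma contDiff_dx (p : Fin n) (hE : ContDiff ℝ 2 E) : ContDiff ℝ 1 (dx p E) :=
  (hE.fderiv_right (m := 1) (by norm_num)).clm_apply contDiff_const

lemma continuous_dt (hE : ContDiff ℝ 1 E) : Continuous (dt E) :=
  (hE.continuous_fderiv one_ne_zero).clm_apply continuous_const

lemma continuous_dx (p : Fin n) (hE : ContDiff ℝ 1 E) : Continuous (dx p E) :=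
  (hE.continuous_fderiv one_ne_zero).clm_apply continuous_const

lemma fderiv_fderiv_apply_comm (hE : ContDiff ℝ 2 E) (z a b : ℝ × (Fin n → ℝ)) :
    fderiv ℝ (fun y => fderiv ℝ E y a) z b = fderiv ℝ (fun y => fderiv ℝ E y b) z a := by
  have hd : DifferentiableAt ℝ (fderiv ℝ E) z :=
    (hE.fderiv_right (m := 1) (by norm_num)).differentiable one_ne_zero z
  have hs : IsSymmSndFDerivAt ℝ E z := hE.contDiffAt.isSymmSndFDerivAt (by simp)
  rw [fderiv_clm_apply hd (differentiableAt_const _), fderiv_clm_apply hd (differentiableAt_const _)]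
  simpa using hs b a

lemma dx_dt_comm (p : Fin n) (hE : ContDiff ℝ 2 E) : dx p (dt E) = dt (dx p E) :=
  funext fun z => fderiv_fderiv_apply_comm hE z _ _

lemma dx_dx_comm (p q : Fin n) (hE : ContDiff ℝ 2 E) : dx p (dx q E) = dx q (dx p E) :=
  funext fun z => fderiv_fderiv_apply_comm hE z _ _

lemma hasDerivAt_dt (hE : Differentiable ℝ E) (t : ℝ) (x : Fin n → ℝ) :
    HasDerivAt (fun s => E (s, x)) (dt E (t, x)) t :=
  (hE (t, x)).hasFDerivAt.comp_hasDerivAt t ((hasDerivAt_id t).prodMk (hasDerivAt_const t x))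

lemma hasDerivAt_dx (p : Fin n) (hE : Differentiable ℝ E) (t : ℝ) (x : Fin n → ℝ) :
    HasDerivAt (fun s : ℝ => E (t, x + s • Pi.single p 1)) (dx p E (t, x)) 0 := by
  have h : HasDerivAt (fun s : ℝ => x + s • (Pi.single p 1 : Fin n → ℝ)) (Pi.single p 1) 0 := by
    simpa using ((hasDerivAt_id (0 : ℝ)).smul_const (Pi.single p 1 : Fin n → ℝ)).const_add x
  have h2 := (hasDerivAt_const (0 : ℝ) t).prodMk h
  have h3 : HasFDerivAt E (fderiv ℝ E (t, x)) (t, x + (0 : ℝ) • (Pi.single p 1 : Fin n → ℝ)) := by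
    simpa using (hE (t, x)).hasFDerivAt
  exact h3.comp_hasDerivAt (0 : ℝ) h2

lemma pd_slice (p : Fin n) (hE : Differentiable ℝ E) (t : ℝ) (x : Fin n → ℝ) :
    pd p (fun y => E (t, y)) x = dx p E (t, x) := by
  have h : HasFDerivAt (fun y => E (t, y)) ((fderiv ℝ E (t, x)).comp
      (ContinuousLinearMap.inr ℝ ℝ (Fin n → ℝ))) x :=
    (hE (t, x)).hasFDerivAt.comp x (hasFDerivAt_prodMk_right t x)
  rw [pd, h.fderiv]
  simp [dx]

lemma contDiff_slice {m : WithTop ℕ∞} (hE : ContDiff ℝ m E) (t : ℝ) :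
    ContDiff ℝ m fun x => E (t, x) :=
  hE.comp (contDiff_const.prodMk contDiff_id)

lemma continuous_slice (hE : Continuous E) (t : ℝ) : Continuous fun x => E (t, x) :=
  hE.comp (Continuous.prodMk_right t)

lemma hasDerivAt_integral_cube {W W' : ℝ × (Fin n → ℝ) → ℝ} (hW : Continuous W)
    (hW' : Continuous W') (hd : ∀ t x, HasDerivAt (fun s => W (s, x)) (W' (t, x)) t) (t : ℝ) :
    HasDerivAt (fun s => ∫ x in cube n, W (s, x)) (∫ x in cube n, W' (t, x)) t := by
  obtain ⟨C, hC⟩ := ((isCompact_Icc (a := t - 1) (b := t + 1)).prod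
    (isCompact_cube n)).exists_bound_of_continuousOn hW'.continuousOn
  refine (hasDerivAt_integral_of_dominated_loc_of_deriv_le (bound := fun _ => C)
    (F := fun s x => W (s, x)) (F' := fun s x => W' (s, x))
    (Icc_mem_nhds (by linarith) (by linarith) : Set.Icc (t - 1) (t + 1) ∈ nhds t)
    (Filter.Eventually.of_forall fun s => (continuous_slice hW s).aestronglyMeasurable)
    (integrableOn_cube (continuous_slice hW t)) (continuous_slice hW' t).aestronglyMeasurable
    ?_ (integrableOn_cube continuous_const) ?_).2
  · refine (ae_restrict_iff' (measurableSet_cube n)).2 (Filter.Eventually.of_forall ?_)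
    exact fun x hx s hs => hC (s, x) ⟨hs, hx⟩
  · exact Filter.Eventually.of_forall fun x s _ => hd s x

/-- Two differentiable functions agreeing on a coordinate segment of the cube have the same
partial derivative along it. -/
lemma pd_eq_of_eqOn_segment {u w : (Fin n → ℝ) → ℝ} (p : Fin n) {x : Fin n → ℝ}
    (hx : x ∈ cube n) (hu : Differentiable ℝ u) (hw : Differentiable ℝ w)
    (h : ∀ s ∈ Set.Icc (0 : ℝ) 1, u (Function.update x p s) = w (Function.update x p s)) :
    pd p u x = pd p w x := by
  have h1 := (hasDerivAt_update_line p hu x (x p)).hasDerivWithinAt (s := Set.Icc 0 1)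
  have h2 := (hasDerivAt_update_line p hw x (x p)).hasDerivWithinAt (s := Set.Icc 0 1)
  have hxp : x p ∈ Set.Icc (0 : ℝ) 1 := hx p trivial
  have h3 := (uniqueDiffOn_Icc zero_lt_one _ hxp).eq_deriv _ h1 (h2.congr h (h _ hxp))
  simpa using h3

lemma pd_congr_cube {u w : (Fin n → ℝ) → ℝ} (p : Fin n) {x : Fin n → ℝ}
    (hx : x ∈ cube n) (hu : Differentiable ℝ u) (hw : Differentiable ℝ w)
    (h : ∀ y ∈ cube n, u y = w y) : pd p u x = pd p w x :=
  pd_eq_of_eqOn_segment p hx hu hw fun _ hs => h _ (update_mem_cube hx p hs)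

/-- Component `p` of the flux whose divergence is, up to zeroth order terms, the time derivative
of the density of the Lyapunov functional. -/
def flux (χ : ℝ) (E : ℝ × (Fin n → ℝ) → ℝ) (p : Fin n) (z : ℝ × (Fin n → ℝ)) : ℝ :=
  dt E z * dx p E z + χ * (z.2 p * dt E z ^ 2 + 2 * (∑ q, z.2 q * dx q E z) * dx p E z
    - z.2 p * ∑ q, dx q E z ^ 2 + ((n : ℝ) - 1) * (E z * dx p E z))

lemma contDiff_flux (χ : ℝ) (hE : ContDiff ℝ 2 E) (p : Fin n) : ContDiff ℝ 1 (flux χ E p) := by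
  have h1 := contDiff_dt hE
  have h2 := fun q => contDiff_dx q hE
  have h3 : ContDiff ℝ 1 E := hE.of_le (by norm_num)
  have h4 : ∀ q : Fin n, ContDiff ℝ 1 fun z : ℝ × (Fin n → ℝ) => z.2 q := fun q => by fun_prop
  have h5 : ContDiff ℝ 1 fun z => ∑ q, z.2 q * dx q E z :=
    ContDiff.sum fun q _ => (h4 q).mul (h2 q)
  have h6 : ContDiff ℝ 1 fun z => ∑ q, dx q E z ^ 2 := ContDiff.sum fun q _ => (h2 q).pow 2
  have h7 := h2 p
  have h8 := h4 p
  unfold flux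
  fun_prop

lemma dx_flux (χ : ℝ) (hE : ContDiff ℝ 2 E) (p : Fin n) (t : ℝ) (x : Fin n → ℝ) :
    dx p (flux χ E p) (t, x) =
      dt (dx p E) (t, x) * dx p E (t, x) + dt E (t, x) * dx p (dx p E) (t, x) +
      χ * (dt E (t, x) ^ 2 + x p * (2 * dt E (t, x) * dt (dx p E) (t, x))
        + 2 * ((dx p E (t, x) + ∑ q, x q * dx p (dx q E) (t, x)) * dx p E (t, x)
          + (∑ q, x q * dx q E (t, x)) * dx p (dx p E) (t, x))
        - (∑ q, dx q E (t, x) ^ 2 + x p * ∑ q, 2 * dx q E (t, x) * dx p (dx q E) (t, x))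
        + (n - 1) * (dx p E (t, x) * dx p E (t, x) + E (t, x) * dx p (dx p E) (t, x))) := by
  have hE1 : ContDiff ℝ 1 E := hE.of_le (by norm_num)
  have d0 := hasDerivAt_dx p (hE1.differentiable one_ne_zero) t x
  have d1 := hasDerivAt_dx p ((contDiff_dt hE).differentiable one_ne_zero) t x
  have d2 := fun q => hasDerivAt_dx p ((contDiff_dx q hE).differentiable one_ne_zero) t x
  have d3 : ∀ q, HasDerivAt (fun s : ℝ => (x + s • (Pi.single p 1 : Fin n → ℝ)) q)
      ((Pi.single p 1 : Fin n → ℝ) q) 0 := fun q => by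
    simpa using ((hasDerivAt_id (0 : ℝ)).mul_const ((Pi.single p 1 : Fin n → ℝ) q)).const_add (x q)
  have d4 := HasDerivAt.fun_sum fun q (_ : q ∈ Finset.univ) => (d3 q).fun_mul (d2 q)
  have d5 := HasDerivAt.fun_sum fun q (_ : q ∈ Finset.univ) => (d2 q).fun_pow 2
  have d6 := (d1.fun_mul (d2 p)).fun_add (((((d3 p).fun_mul (d1.fun_pow 2)).fun_add
    ((d4.const_mul 2).fun_mul (d2 p))).fun_sub ((d3 p).fun_mul d5)).fun_add
    ((d0.fun_mul (d2 p)).const_mul ((n : ℝ) - 1)) |>.const_mul χ)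
  have d7 := hasDerivAt_dx p ((contDiff_flux χ hE p).differentiable one_ne_zero) t x
  rw [d7.unique d6]
  have hs : ∑ q, (Pi.single p 1 : Fin n → ℝ) q * dx q E (t, x) = dx p E (t, x) := by
    simp [Pi.single_apply]
  simp only [zero_smul, add_zero, Finset.sum_add_distrib, hs, Pi.single_eq_same, dx_dt_comm p hE,
    Nat.cast_ofNat, Nat.add_one_sub_one, pow_one]
  ring

lemma divergence_identity (a bx x : Fin n → ℝ) (H : Fin n → Fin n → ℝ) (hH : ∀ p q, H p q = H q p)
    (b c e χ : ℝ) :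
    1 / 2 * (∑ p, 2 * a p * bx p + 2 * b * c) +
        χ * ((2 * ∑ p, x p * bx p + ((n : ℝ) - 1) * b) * b
          + (2 * ∑ p, x p * a p + ((n : ℝ) - 1) * e) * c) =
      (∑ p, (bx p * a p + b * H p p + χ * (b ^ 2 + x p * (2 * b * bx p)
        + 2 * ((a p + ∑ q, x q * H p q) * a p + (∑ q, x q * a q) * H p p)
        - (∑ q, a q ^ 2 + x p * ∑ q, 2 * a q * H p q)
        + (n - 1) * (a p * a p + e * H p p)))) +
      (b * (c - ∑ p, H p p) + χ * ((2 * ∑ p, x p * a p + ((n : ℝ) - 1) * e) * (c - ∑ p, H p p))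
        - χ * (∑ p, a p ^ 2 + b ^ 2)) := by
  have hK : ∑ p, x p * ∑ q, a q * H p q = ∑ p, a p * ∑ q, x q * H p q := by
    simp only [Finset.mul_sum]
    rw [Finset.sum_comm]
    refine Finset.sum_congr rfl fun p _ => Finset.sum_congr rfl fun q _ => ?_
    rw [hH p q]
    ring
  have hsum : ∀ p, bx p * a p + b * H p p + χ * (b ^ 2 + x p * (2 * b * bx p)
        + 2 * ((a p + ∑ q, x q * H p q) * a p + (∑ q, x q * a q) * H p p)
        - (∑ q, a q ^ 2 + x p * ∑ q, 2 * a q * H p q)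
        + (n - 1) * (a p * a p + e * H p p)) =
      a p * bx p + b * H p p + χ * b ^ 2 + 2 * χ * b * (x p * bx p) + 2 * χ * (a p ^ 2)
        + 2 * χ * (a p * ∑ q, x q * H p q) + 2 * χ * (∑ q, x q * a q) * H p p
        + (-(χ * ∑ q, a q ^ 2)) + (-(2 * χ)) * (x p * ∑ q, a q * H p q)
        + χ * (n - 1) * (a p ^ 2) + χ * (n - 1) * e * H p p := fun p => by
    have : ∑ q, 2 * a q * H p q = 2 * ∑ q, a q * H p q := by
      rw [Finset.mul_sum]
      exact Finset.sum_congr rfl fun q _ => by ring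
    rw [this]
    ring
  have h2 : ∑ p, 2 * a p * bx p = 2 * ∑ p, a p * bx p := by
    rw [Finset.mul_sum]
    exact Finset.sum_congr rfl fun q _ => by ring
  simp only [hsum, Finset.sum_add_distrib, ← Finset.mul_sum, Finset.sum_const, Finset.card_univ,
    Fintype.card_fin, nsmul_eq_mul, hK, h2]
  ring

lemma flux_eq_zero_of_dirichlet {χ t : ℝ} {p : Fin n} {x : Fin n → ℝ} (hp : x p = 0)
    (h0 : E (t, x) = 0) (h1 : dt E (t, x) = 0) (h2 : ∀ q, q ≠ p → dx q E (t, x) = 0) :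
    flux χ E p (t, x) = 0 := by
  have hs : ∑ q, x q * dx q E (t, x) = 0 := Finset.sum_eq_zero fun q _ => by
    by_cases h : q = p
    · rw [h, hp, zero_mul]
    · rw [h2 q h, mul_zero]
  simp [flux, hs, hp, h0, h1]

lemma flux_le_of_neumann {k χ t : ℝ} (hχ : 0 < χ) (hΨ1 : -k + (1 + k ^ 2 * n) * χ ≤ 0) {p : Fin n}
    {x : Fin n → ℝ} (hx : x ∈ cube n) (hp : x p = 1)
    (h : dx p E (t, x) = -k * dt E (t, x)) :
    flux χ E p (t, x) + χ * k * (n - 1) * (E (t, x) * dt E (t, x)) ≤ 0 := by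
  set a : Fin n → ℝ := fun q => dx q E (t, x) with ha
  have hterm : ∀ q, 2 * (x q * a q) * a p - a q ^ 2 ≤ x q ^ 2 * a p ^ 2 := fun q => by
    nlinarith [sq_nonneg (x q * a p - a q)]
  have hsum : 2 * (∑ q, x q * a q) * a p - ∑ q, a q ^ 2 ≤ n * a p ^ 2 := by
    calc 2 * (∑ q, x q * a q) * a p - ∑ q, a q ^ 2
        = ∑ q, (2 * (x q * a q) * a p - a q ^ 2) := by
          rw [Finset.sum_sub_distrib, ← Finset.sum_mul, ← Finset.mul_sum]
      _ ≤ ∑ q, x q ^ 2 * a p ^ 2 := Finset.sum_le_sum fun q _ => hterm q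
      _ = (∑ q, x q ^ 2) * a p ^ 2 := by rw [Finset.sum_mul]
      _ ≤ n * a p ^ 2 := mul_le_mul_of_nonneg_right (sum_sq_le_of_mem_cube hx) (sq_nonneg _)
  have hap : a p = -k * dt E (t, x) := h
  have h1 := mul_le_mul_of_nonneg_left hsum hχ.le
  have h2 := mul_nonpos_of_nonpos_of_nonneg hΨ1 (sq_nonneg (dt E (t, x)))
  change dt E (t, x) * a p + χ * (x p * dt E (t, x) ^ 2 + 2 * (∑ q, x q * a q) * a p
    - x p * ∑ q, a q ^ 2 + ((n : ℝ) - 1) * (E (t, x) * a p)) + _ ≤ 0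
  rw [hp]
  rw [hap] at h1 ⊢
  linarith

end

section

variable {n : ℕ} {E : ℝ × (Fin n → ℝ) → ℝ}

lemma hasDerivAt_integral_lyap_density (χ : ℝ) (hE : ContDiff ℝ 2 E) (t : ℝ) :
    HasDerivAt (fun s => ∫ x in cube n, (1 / 2 * (∑ p, dx p E (s, x) ^ 2 + dt E (s, x) ^ 2) +
        χ * ((2 * ∑ p, x p * dx p E (s, x) + ((n : ℝ) - 1) * E (s, x)) * dt E (s, x))))
      (∫ x in cube n, (1 / 2 * (∑ p, 2 * dx p E (t, x) * dt (dx p E) (t, x) +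
          2 * dt E (t, x) * dt (dt E) (t, x)) +
        χ * ((2 * ∑ p, x p * dt (dx p E) (t, x) + ((n : ℝ) - 1) * dt E (t, x)) * dt E (t, x)
          + (2 * ∑ p, x p * dx p E (t, x) + ((n : ℝ) - 1) * E (t, x)) * dt (dt E) (t, x)))) t := by
  have hE1 : ContDiff ℝ 1 E := hE.of_le (by norm_num)
  have c0 := hE1.continuous
  have c1 := (contDiff_dt hE).continuous
  have c2 := fun p => (contDiff_dx p hE).continuous
  have c3 := continuous_dt (contDiff_dt hE)
  have c4 := fun p => continuous_dt (contDiff_dx p hE)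
  refine hasDerivAt_integral_cube
    (W := fun z => 1 / 2 * (∑ p, dx p E z ^ 2 + dt E z ^ 2) +
        χ * ((2 * ∑ p, z.2 p * dx p E z + ((n : ℝ) - 1) * E z) * dt E z))
    (W' := fun z => 1 / 2 * (∑ p, 2 * dx p E z * dt (dx p E) z + 2 * dt E z * dt (dt E) z) +
        χ * ((2 * ∑ p, z.2 p * dt (dx p E) z + ((n : ℝ) - 1) * dt E z) * dt E z
          + (2 * ∑ p, z.2 p * dx p E z + ((n : ℝ) - 1) * E z) * dt (dt E) z))
    (by fun_prop) (by fun_prop) (fun s x => ?_) t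
  have d0 := hasDerivAt_dt (hE1.differentiable one_ne_zero) s x
  have d1 := hasDerivAt_dt ((contDiff_dt hE).differentiable one_ne_zero) s x
  have d2 := fun p => hasDerivAt_dt ((contDiff_dx p hE).differentiable one_ne_zero) s x
  have d3 := HasDerivAt.fun_sum fun p (_ : p ∈ Finset.univ) => (d2 p).fun_pow 2
  have d4 := HasDerivAt.fun_sum fun p (_ : p ∈ Finset.univ) => (d2 p).const_mul (x p)
  refine ((d3.fun_add (d1.fun_pow 2)).const_mul (1 / 2) |>.fun_add
    ((((d4.const_mul 2).fun_add (d0.const_mul ((n : ℝ) - 1))).fun_mul d1).const_mul χ)).congr_deriv ?_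
  norm_num

lemma hasDerivAt_faceInt_sq (hE : ContDiff ℝ 2 E) (t : ℝ) :
    HasDerivAt (fun s => faceInt fun x => E (s, x) ^ 2)
      (∑ p : Fin n, ∫ x in cube n,
        2 * (E (t, Function.update x p 1) * dt E (t, Function.update x p 1))) t := by
  have hE1 : ContDiff ℝ 1 E := hE.of_le (by norm_num)
  have c0 := hE1.continuous
  have c1 := (contDiff_dt hE).continuous
  refine HasDerivAt.fun_sum fun p _ => ?_
  have hu : Continuous fun z : ℝ × (Fin n → ℝ) => (z.1, Function.update z.2 p (1 : ℝ)) :=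
    continuous_fst.prodMk ((continuous_update_left p 1).comp continuous_snd)
  have h0 := c0.comp hu
  have h1 := c1.comp hu
  refine hasDerivAt_integral_cube (W := fun z => E (z.1, Function.update z.2 p 1) ^ 2)
    (W' := fun z => 2 * (E (z.1, Function.update z.2 p 1) * dt E (z.1, Function.update z.2 p 1)))
    (h0.pow 2) ((h0.mul h1).const_mul 2) (fun s x => ?_) t
  refine ((hasDerivAt_dt (hE1.differentiable one_ne_zero) s
    (Function.update x p 1)).fun_pow 2).congr_deriv ?_
  norm_num
  ring

lemma hasDerivAt_lyap (k χ : ℝ) (hE : ContDiff ℝ 2 E) {f : ℝ → (Fin n → ℝ) → ℝ}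
    (hf : ∀ t x, f t x = dt (dt E) (t, x) - ∑ p, dx p (dx p E) (t, x)) (t : ℝ) :
    HasDerivAt (fun s => lyap k χ (fun x => E (s, x)) fun x => dt E (s, x))
      ((∑ p, ∫ x in cube n, (flux χ E p (t, Function.update x p 1)
          - flux χ E p (t, Function.update x p 0)
          + χ * k * (n - 1) * (E (t, Function.update x p 1) * dt E (t, Function.update x p 1)))) +
        ∫ x in cube n, (dt E (t, x) * f t x + χ * crossDensity (fun x => E (t, x)) (f t) x
          - χ * (gradSq (fun x => E (t, x)) x + dt E (t, x) ^ 2))) t := by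
  have hE1 : ContDiff ℝ 1 E := hE.of_le (by norm_num)
  have hEd := hE1.differentiable one_ne_zero
  have c0 := continuous_slice hE1.continuous t
  have c1 := continuous_slice (contDiff_dt hE).continuous t
  have c2 := fun p => continuous_slice (contDiff_dx p hE).continuous t
  have c3 := continuous_slice (continuous_dt (contDiff_dt hE)) t
  have c4 := fun p => continuous_slice (continuous_dx p (contDiff_dx p hE)) t
  have hlyap : (fun s => lyap k χ (fun x => E (s, x)) fun x => dt E (s, x)) = fun s =>
      (∫ x in cube n, (1 / 2 * (∑ p, dx p E (s, x) ^ 2 + dt E (s, x) ^ 2) +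
        χ * ((2 * ∑ p, x p * dx p E (s, x) + ((n : ℝ) - 1) * E (s, x)) * dt E (s, x)))) +
      χ * k * (n - 1) / 2 * faceInt fun x => E (s, x) ^ 2 := by
    funext s
    simp only [lyap, gradSq, crossDensity, xGrad, pd_slice _ hEd]
  rw [hlyap]
  refine ((hasDerivAt_integral_lyap_density χ hE t).fun_add
    ((hasDerivAt_faceInt_sq hE t).const_mul (χ * k * (n - 1) / 2))).congr_deriv ?_
  have hflux : ∀ p, ∫ x in cube n, dx p (flux χ E p) (t, x) = ∫ x in cube n,
      (flux χ E p (t, Function.update x p 1) - flux χ E p (t, Function.update x p 0)) := fun p => by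
    rw [← integral_cube_pd p (contDiff_slice (contDiff_flux χ hE p) t)]
    simp only [pd_slice p ((contDiff_flux χ hE p).differentiable one_ne_zero)]
  have hcont : ∀ p, Continuous fun x => dx p (flux χ E p) (t, x) := fun p =>
    continuous_slice (continuous_dx p (contDiff_flux χ hE p)) t
  have hpoint : ∀ x, 1 / 2 * (∑ p, 2 * dx p E (t, x) * dt (dx p E) (t, x) +
          2 * dt E (t, x) * dt (dt E) (t, x)) +
        χ * ((2 * ∑ p, x p * dt (dx p E) (t, x) + ((n : ℝ) - 1) * dt E (t, x)) * dt E (t, x)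
          + (2 * ∑ p, x p * dx p E (t, x) + ((n : ℝ) - 1) * E (t, x)) * dt (dt E) (t, x)) =
      (∑ p, dx p (flux χ E p) (t, x)) +
        (dt E (t, x) * f t x + χ * crossDensity (fun x => E (t, x)) (f t) x
          - χ * (gradSq (fun x => E (t, x)) x + dt E (t, x) ^ 2)) := fun x => by
    simp only [dx_flux χ hE, gradSq, crossDensity, xGrad, pd_slice _ hEd, hf]
    exact divergence_identity (fun p => dx p E (t, x)) (fun p => dt (dx p E) (t, x)) x
      (fun p q => dx p (dx q E) (t, x)) (fun p q => congrFun (dx_dx_comm p q hE) _) _ _ _ χ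
  have hfc : Continuous (f t) := by
    rw [show f t = fun x => dt (dt E) (t, x) - ∑ p, dx p (dx p E) (t, x) from funext (hf t)]
    fun_prop
  have hJ := continuous_crossDensity (contDiff_slice hE1 t) hfc
  have hG := continuous_gradSq (contDiff_slice hE1 t)
  simp only [hpoint]
  rw [integral_cube_add (continuous_finsetSum _ fun p _ => hcont p) (by fun_prop),
    integral_finsetSum _ fun p _ => integrableOn_cube (hcont p)]
  have hsplit : ∀ p, ∫ x in cube n, (flux χ E p (t, Function.update x p 1)
          - flux χ E p (t, Function.update x p 0)
          + χ * k * (n - 1) * (E (t, Function.update x p 1) * dt E (t, Function.update x p 1))) =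
      (∫ x in cube n, dx p (flux χ E p) (t, x)) + χ * k * (n - 1) / 2 * ∫ x in cube n,
        2 * (E (t, Function.update x p 1) * dt E (t, Function.update x p 1)) := fun p => by
    have c5 : ∀ s, Continuous fun x => flux χ E p (t, Function.update x p s) := fun s =>
      (continuous_slice (contDiff_flux χ hE p).continuous t).comp (continuous_update_left p s)
    have c6 : Continuous fun x => χ * k * (n - 1) *
        (E (t, Function.update x p 1) * dt E (t, Function.update x p 1)) :=
      ((c0.mul c1).comp (continuous_update_left p 1)).const_mul _
    rw [hflux, integral_cube_add ((c5 1).fun_sub (c5 0)) c6, integral_const_mul, integral_const_mul]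
    ring
  simp only [hsplit, Finset.sum_add_distrib, ← Finset.mul_sum]
  ring

lemma dt_eq_zero_of_eq_zero_on {t0 t1 t : ℝ} (hE : Differentiable ℝ E) (ht : t ∈ Set.Ioo t0 t1)
    {x : Fin n → ℝ} (h : ∀ s ∈ Set.Icc t0 t1, E (s, x) = 0) : dt E (t, x) = 0 := by
  have h1 : (fun s => E (s, x)) =ᶠ[nhds t] fun _ => 0 :=
    Filter.eventually_of_mem (Icc_mem_nhds ht.1 ht.2) h
  exact (hasDerivAt_dt hE t x).unique ((hasDerivAt_const t 0).congr_of_eventuallyEq h1)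

/-- Exponential decay of the Lyapunov functional along solutions with boundary damping. -/
lemma lyap_decay_spacetime (hn : 1 ≤ n) {k χ δ g1 lam1 t0 t1 : ℝ} (hk : 0 < k) (hχ : 0 < χ)
    (hδ : 0 < δ) (hl1 : 0 < lam1) (hΨ1 : -k + (1 + k ^ 2 * n) * χ ≤ 0)
    (hΨ2 : NegSemidefM (Psi2 n k χ δ g1 lam1)) (ht : t0 ≤ t1) (hE : ContDiff ℝ 2 E)
    (hwave : ∀ t ∈ Set.Ioo t0 t1, ∀ x ∈ cube n,
      |dt (dt E) (t, x) - ∑ p, dx p (dx p E) (t, x)| ≤ g1 * |E (t, x)|)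
    (hDir : ∀ t ∈ Set.Icc t0 t1, ∀ x ∈ cube n, (∃ p, x p = 0) → E (t, x) = 0)
    (hNeu : ∀ t ∈ Set.Icc t0 t1, ∀ x ∈ cube n, ∀ p, x p = 1 →
      dx p E (t, x) = -k * dt E (t, x)) :
    lyap k χ (fun x => E (t1, x)) (fun x => dt E (t1, x)) ≤
      exp (-2 * δ * (t1 - t0)) * lyap k χ (fun x => E (t0, x)) (fun x => dt E (t0, x)) := by
  have hE1 : ContDiff ℝ 1 E := hE.of_le (by norm_num)
  have hEd := hE1.differentiable one_ne_zero
  set f : ℝ → (Fin n → ℝ) → ℝ := fun t x => dt (dt E) (t, x) - ∑ p, dx p (dx p E) (t, x) with hf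
  set V : ℝ → ℝ := fun s => lyap k χ (fun x => E (s, x)) fun x => dt E (s, x) with hV
  have hd := hasDerivAt_lyap k χ hE (f := f) fun _ _ => rfl
  have hderiv : ∀ t ∈ Set.Ioo t0 t1, deriv V t + 2 * δ * V t ≤ 0 := by
    intro t ht
    have ht' := Set.Ioo_subset_Icc_self ht
    have hfc : Continuous (f t) := by
      have c3 := continuous_slice (continuous_dt (contDiff_dt hE)) t
      have c4 := fun p => continuous_slice (continuous_dx p (contDiff_dx p hE)) t
      fun_prop
    have hvol := integral_add_two_mul_lyap_nonpos hn hk hχ hδ hl1 hΨ2 (contDiff_slice hE1 t)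
      (continuous_slice (contDiff_dt hE).continuous t) hfc (hDir t ht') (hwave t ht)
    have hbd : ∀ p : Fin n, ∫ x in cube n, (flux χ E p (t, Function.update x p 1)
        - flux χ E p (t, Function.update x p 0)
        + χ * k * (n - 1) * (E (t, Function.update x p 1) * dt E (t, Function.update x p 1)))
        ≤ 0 := by
      intro p
      refine setIntegral_nonpos (measurableSet_cube n) fun x hx => ?_
      have hx0 := update_mem_cube hx p (s := 0) (by simp)
      have hx1 := update_mem_cube hx p (s := 1) (by simp)
      have h0 : flux χ E p (t, Function.update x p 0) = 0 := by
        refine flux_eq_zero_of_dirichlet (by simp) (hDir t ht' _ hx0 ⟨p, by simp⟩)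
          (dt_eq_zero_of_eq_zero_on hEd ht fun s hs => hDir s hs _ hx0 ⟨p, by simp⟩)
          fun q hq => ?_
        rw [← pd_slice q hEd, pd_eq_of_eqOn_segment q hx0
          ((contDiff_slice hE1 t).differentiable one_ne_zero) (differentiable_const (0 : ℝ))]
        · simp [pd]
        · exact fun s hs => hDir t ht' _ (update_mem_cube hx0 q hs) ⟨p, by simp [hq.symm]⟩
      have h1 := flux_le_of_neumann hχ hΨ1 hx1 (by simp) (hNeu t ht' _ hx1 p (by simp))
      rw [h0]
      linarith
    rw [(hd t).deriv]
    have := Finset.sum_nonpos fun p (_ : p ∈ Finset.univ) => hbd p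
    linarith
  have hexp : ∀ t, HasDerivAt (fun s => exp (2 * δ * s)) (exp (2 * δ * t) * (2 * δ)) t := fun t =>
    by simpa using ((hasDerivAt_id t).const_mul (2 * δ)).exp
  have hprod : ∀ t, HasDerivAt (fun s => exp (2 * δ * s) * V s)
      (exp (2 * δ * t) * (2 * δ) * V t + exp (2 * δ * t) * deriv V t) t := fun t =>
    (hexp t).mul (hd t).differentiableAt.hasDerivAt
  have hanti : AntitoneOn (fun s => exp (2 * δ * s) * V s) (Set.Icc t0 t1) := by
    refine antitoneOn_of_deriv_nonpos (convex_Icc _ _)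
      (fun t _ => (hprod t).continuousAt.continuousWithinAt)
      (fun t _ => (hprod t).differentiableAt.differentiableWithinAt) fun t ht => ?_
    rw [interior_Icc] at ht
    rw [(hprod t).deriv]
    nlinarith [mul_nonpos_of_nonneg_of_nonpos (exp_pos (2 * δ * t)).le (hderiv t ht)]
  have hfinal := hanti (Set.left_mem_Icc.2 ht) (Set.right_mem_Icc.2 ht) ht
  have he : exp (-2 * δ * (t1 - t0)) = exp (2 * δ * t0) / exp (2 * δ * t1) := by
    rw [← exp_sub]
    ring_nf
  change V t1 ≤ _ * V t0
  rw [he, div_mul_eq_mul_div, le_div_iff₀ (exp_pos _), mul_comm]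
  exact hfinal

end

section

variable {n : ℕ} {e : ℝ → (Fin n → ℝ) → ℝ}

lemma lyap_decay_forward (hn : 1 ≤ n) {k χ δ g1 lam1 t0 t1 : ℝ} (hk : 0 < k) (hχ : 0 < χ)
    (hδ : 0 < δ) (hl1 : 0 < lam1) (hΨ1 : -k + (1 + k ^ 2 * n) * χ ≤ 0)
    (hΨ2 : NegSemidefM (Psi2 n k χ δ g1 lam1)) (ht : t0 ≤ t1)
    (he : ContDiff ℝ 2 fun q : ℝ × (Fin n → ℝ) => e q.1 q.2)
    (hwave : ∀ t ∈ Set.Ioo t0 t1, ∀ x ∈ cube n,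
      |deriv (deriv fun s => e s x) t - lap (e t) x| ≤ g1 * |e t x|)
    (hDir : ∀ t ∈ Set.Icc t0 t1, ∀ x ∈ cube n, (∃ p, x p = 0) → e t x = 0)
    (hNeu : ∀ t ∈ Set.Icc t0 t1, ∀ x ∈ cube n, ∀ p, x p = 1 →
      pd p (e t) x = -k * deriv (fun s => e s x) t) :
    lyap k χ (e t1) (fun x => deriv (fun s => e s x) t1) ≤
      exp (-2 * δ * (t1 - t0)) * lyap k χ (e t0) (fun x => deriv (fun s => e s x) t0) := by
  set E : ℝ × (Fin n → ℝ) → ℝ := fun q => e q.1 q.2 with hE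
  have hEd : Differentiable ℝ E := (he.of_le (by norm_num : (1 : WithTop ℕ∞) ≤ 2)).differentiable
    one_ne_zero
  have hdt : ∀ x, (deriv fun s => e s x) = fun t => dt E (t, x) := fun x =>
    funext fun t => (hasDerivAt_dt hEd t x).deriv
  have hdx : ∀ p t, pd p (e t) = fun x => dx p E (t, x) := fun p t =>
    funext fun x => pd_slice p hEd t x
  have h := lyap_decay_spacetime hn hk hχ hδ hl1 hΨ1 hΨ2 ht he (fun t ht x hx => ?_) hDir
    (fun t ht x hx p hp => by simpa only [hdt, hdx] using hNeu t ht x hx p hp)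
  · simpa only [hdt] using h
  · have h := hwave t ht x hx
    simp only [hdt, hdx, lap] at h
    rw [(hasDerivAt_dt ((contDiff_dt he).differentiable one_ne_zero) t x).deriv] at h
    simpa only [pd_slice _ ((contDiff_dx _ he).differentiable one_ne_zero)] using h

lemma lyap_decay_backward (hn : 1 ≤ n) {k χ δ g1 lam1 t0 t1 : ℝ} (hk : 0 < k) (hχ : 0 < χ)
    (hδ : 0 < δ) (hl1 : 0 < lam1) (hΨ1 : -k + (1 + k ^ 2 * n) * χ ≤ 0)
    (hΨ2 : NegSemidefM (Psi2 n k χ δ g1 lam1)) (ht : t0 ≤ t1)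
    (he : ContDiff ℝ 2 fun q : ℝ × (Fin n → ℝ) => e q.1 q.2)
    (hwave : ∀ t ∈ Set.Ioo t0 t1, ∀ x ∈ cube n,
      |deriv (deriv fun s => e s x) t - lap (e t) x| ≤ g1 * |e t x|)
    (hDir : ∀ t ∈ Set.Icc t0 t1, ∀ x ∈ cube n, (∃ p, x p = 0) → e t x = 0)
    (hNeu : ∀ t ∈ Set.Icc t0 t1, ∀ x ∈ cube n, ∀ p, x p = 1 →
      pd p (e t) x = k * deriv (fun s => e s x) t) :
    lyap k χ (e t0) (fun x => -deriv (fun s => e s x) t0) ≤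
      exp (-2 * δ * (t1 - t0)) * lyap k χ (e t1) (fun x => -deriv (fun s => e s x) t1) := by
  have hd : ∀ x, (deriv fun s => e (t0 + t1 - s) x) =
      fun t => -deriv (fun s => e s x) (t0 + t1 - t) := fun x =>
    funext fun t => deriv_comp_const_sub (f := fun s => e s x) (t0 + t1) t
  have hdd : ∀ x t, deriv (fun t => -deriv (fun s => e s x) (t0 + t1 - t)) t =
      deriv (deriv fun s => e s x) (t0 + t1 - t) := fun x t => by
    rw [deriv.fun_neg, deriv_comp_const_sub (f := deriv fun s => e s x), neg_neg]
  have hmem : ∀ t ∈ Set.Icc t0 t1, t0 + t1 - t ∈ Set.Icc t0 t1 := fun t h =>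
    ⟨by linarith [h.2], by linarith [h.1]⟩
  have h := lyap_decay_forward (e := fun t => e (t0 + t1 - t)) hn hk hχ hδ hl1 hΨ1 hΨ2 ht
    (he.comp ((contDiff_const.sub contDiff_fst).prodMk contDiff_snd))
    (fun t ht x hx => by
      rw [hd, hdd]
      exact hwave _ ⟨by linarith [ht.2], by linarith [ht.1]⟩ x hx)
    (fun t ht => hDir _ (hmem t ht))
    (fun t ht x hx p hp => by
      rw [hd, hNeu _ (hmem t ht) x hx p hp]
      ring)
  simpa [hd] using h

lemma lyap_congr {k χ : ℝ} {u u' v v' : (Fin n → ℝ) → ℝ} (hu : Differentiable ℝ u)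
    (hu' : Differentiable ℝ u') (h : ∀ x ∈ cube n, u x = u' x ∧ v x = v' x) :
    lyap k χ u v = lyap k χ u' v' := by
  have hpd : ∀ x ∈ cube n, ∀ p, pd p u x = pd p u' x := fun x hx p =>
    pd_congr_cube p hx hu hu' fun y hy => (h y hy).1
  unfold lyap faceInt
  congr 1
  · refine setIntegral_congr_fun (measurableSet_cube n) fun x hx => ?_
    simp only [gradSq, crossDensity, xGrad, hpd x hx, (h x hx).1, (h x hx).2]
  · congr 1
    refine Finset.sum_congr rfl fun p _ => ?_
    refine setIntegral_congr_fun (measurableSet_cube n) fun x hx => ?_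
    simp only [(h _ (update_mem_cube hx p (s := 1) (by simp))).1]

lemma continuous_deriv_slice (he : ContDiff ℝ 2 fun q : ℝ × (Fin n → ℝ) => e q.1 q.2) (t : ℝ) :
    Continuous fun x => deriv (fun s => e s x) t := by
  have hd := (he.of_le (by norm_num : (1 : WithTop ℕ∞) ≤ 2)).differentiable one_ne_zero
  simpa only [(hasDerivAt_dt hd t _).deriv] using continuous_slice (contDiff_dt he).continuous t

end

/-- **Theorem 2(ii): geometric convergence of the iterative forward–backward
observer algorithm (inequality (33)).** Under the LMIs `Φ₀ > 0`, `Ψ₁ ≤ 0`,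
`Ψ₂ ⪯ 0`, `Φ ≺ 0` (with `σ = e^{−2δT*}`) and `T = T* + ΔT`, the backward
estimation errors of the forward–backward iteration satisfy, for all `m ≥ 1`,
`∫_Ω (|∇e^{b(m)}(t₀)|² + e_t^{b(m)}(t₀)²) ≤ (β/α) qᵐ ∫_Ω (|∇z₀|² + z₁²)` with
`q = e^{−4δΔT}`. -/
theorem observer_iteration_convergence (n : ℕ) (hn : 1 ≤ n)
    (k δ g1 Tstar ΔT T t0 : ℝ)
    (hk : 0 < k) (hδ : 0 < δ) (hg1 : 0 < g1) (hTs : 0 < Tstar) (hΔT : 0 < ΔT)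
    (hT : T = Tstar + ΔT)
    (χ lam0 lam1 lam2 : ℝ) (hχ : 0 < χ) (hl0 : 0 < lam0) (hl1 : 0 < lam1) (hl2 : 0 < lam2)
    (hΦ0 : (Phi0 n χ lam0).PosDef)
    (hΨ1 : -k + (1 + k ^ 2 * n) * χ ≤ 0)
    (hΨ2 : NegSemidefM (Psi2 n k χ δ g1 lam1))
    (hΦ : NegDefM (PhiM n χ (Real.exp (-2 * δ * Tstar)) lam2))
    (z0 : (Fin n → ℝ) → ℝ) (hz0 : ContDiff ℝ 1 z0)
    (hz0D : ∀ x ∈ cube n, (∃ p, x p = 0) → z0 x = 0)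
    (z1 : (Fin n → ℝ) → ℝ) (hz1 : Continuous z1)
    (ef eb : ℕ → ℝ → (Fin n → ℝ) → ℝ)
    (gf gb : ℕ → (Fin n → ℝ) → ℝ → ℝ)
    (hef : ∀ m, 1 ≤ m → ContDiff ℝ 2 fun q : ℝ × (Fin n → ℝ) => ef m q.1 q.2)
    (heb : ∀ m, 1 ≤ m → ContDiff ℝ 2 fun q : ℝ × (Fin n → ℝ) => eb m q.1 q.2)
    (hgfc : ∀ m, 1 ≤ m → Continuous fun q : (Fin n → ℝ) × ℝ => gf m q.1 q.2)
    (hgbc : ∀ m, 1 ≤ m → Continuous fun q : (Fin n → ℝ) × ℝ => gb m q.1 q.2)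
    (hgfb : ∀ m, 1 ≤ m → ∀ x ∈ cube n, ∀ t ∈ Set.Icc t0 (t0 + T), |gf m x t| ≤ g1)
    (hgbb : ∀ m, 1 ≤ m → ∀ x ∈ cube n, ∀ t ∈ Set.Icc t0 (t0 + T), |gb m x t| ≤ g1)
    -- forward error systems
    (hwavef : ∀ m, 1 ≤ m → ∀ t ∈ Set.Ioo t0 (t0 + T), ∀ x ∈ cube n,
      deriv (deriv fun s => ef m s x) t = lap (ef m t) x + gf m x t * ef m t x)
    (hDirf : ∀ m, 1 ≤ m → ∀ t ∈ Set.Icc t0 (t0 + T), ∀ x ∈ cube n,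
      (∃ p, x p = 0) → ef m t x = 0)
    (hNeuf : ∀ m, 1 ≤ m → ∀ t ∈ Set.Icc t0 (t0 + T), ∀ x ∈ cube n, ∀ p, x p = 1 →
      pd p (ef m t) x = -k * deriv (fun s => ef m s x) t)
    -- backward error systems
    (hwaveb : ∀ m, 1 ≤ m → ∀ t ∈ Set.Ioo t0 (t0 + T), ∀ x ∈ cube n,
      deriv (deriv fun s => eb m s x) t = lap (eb m t) x + gb m x t * eb m t x)
    (hDirb : ∀ m, 1 ≤ m → ∀ t ∈ Set.Icc t0 (t0 + T), ∀ x ∈ cube n,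
      (∃ p, x p = 0) → eb m t x = 0)
    (hNeub : ∀ m, 1 ≤ m → ∀ t ∈ Set.Icc t0 (t0 + T), ∀ x ∈ cube n, ∀ p, x p = 1 →
      pd p (eb m t) x = k * deriv (fun s => eb m s x) t)
    -- coupling conditions
    (hinit0 : ∀ x ∈ cube n, ef 1 t0 x = z0 x ∧ deriv (fun s => ef 1 s x) t0 = z1 x)
    (hinitm : ∀ m, 2 ≤ m → ∀ x ∈ cube n,
      ef m t0 x = eb (m - 1) t0 x ∧
      deriv (fun s => ef m s x) t0 = deriv (fun s => eb (m - 1) s x) t0)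
    (hfin : ∀ m, 1 ≤ m → ∀ x ∈ cube n,
      eb m (t0 + T) x = ef m (t0 + T) x ∧
      deriv (fun s => eb m s x) (t0 + T) = deriv (fun s => ef m s x) (t0 + T)) :
    ∀ m, 1 ≤ m →
      (∫ x in cube n, (gradSq (eb m t0) x + (deriv (fun s => eb m s x) t0) ^ 2)) ≤
        (betaC n k χ lam0 / alphaC n χ lam0) * (Real.exp (-4 * δ * ΔT)) ^ m *
          ∫ x in cube n, (gradSq z0 x + (z1 x) ^ 2) := by
  have hσ0 := exp_pos (-2 * δ * Tstar)
  have hσ1 : exp (-2 * δ * Tstar) ≤ 1 := exp_le_one_iff.2 (by nlinarith [mul_pos hδ hTs])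
  set σ := exp (-2 * δ * Tstar) with hσ
  set q := exp (-4 * δ * ΔT) with hq
  have hq0 : 0 < q := exp_pos _
  have hεσ : exp (-2 * δ * (t0 + T - t0)) * exp (-2 * δ * (t0 + T - t0)) = σ * (σ * q) := by
    rw [hσ, hq, ← exp_add, ← exp_add, ← exp_add, hT]
    ring_nf
  set ε := exp (-2 * δ * (t0 + T - t0))
  have hε0 : 0 < ε := exp_pos _
  have hT0 : t0 ≤ t0 + T := by linarith
  have hl := Set.left_mem_Icc.2 hT0
  have hr := Set.right_mem_Icc.2 hT0
  have hwave : ∀ {a b g y : ℝ}, a = b + g * y → |g| ≤ g1 → |a - b| ≤ g1 * |y| :=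
    fun {a b g y} h hg => by
      rw [h, add_sub_cancel_left, abs_mul]
      exact mul_le_mul_of_nonneg_right hg (abs_nonneg y)
  have hforward : ∀ m, 1 ≤ m →
      lyap k χ (ef m (t0 + T)) (fun x => deriv (fun s => ef m s x) (t0 + T)) ≤
        ε * lyap k χ (ef m t0) (fun x => deriv (fun s => ef m s x) t0) := fun m hm =>
    lyap_decay_forward hn hk hχ hδ hl1 hΨ1 hΨ2 hT0 (hef m hm)
      (fun t ht x hx => hwave (hwavef m hm t ht x hx)
        (hgfb m hm x hx t (Set.Ioo_subset_Icc_self ht))) (hDirf m hm) (hNeuf m hm)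
  have hbackward : ∀ m, 1 ≤ m →
      lyap k χ (eb m t0) (fun x => -deriv (fun s => eb m s x) t0) ≤
        ε * lyap k χ (eb m (t0 + T)) (fun x => -deriv (fun s => eb m s x) (t0 + T)) := fun m hm =>
    lyap_decay_backward hn hk hχ hδ hl1 hΨ1 hΨ2 hT0 (heb m hm)
      (fun t ht x hx => hwave (hwaveb m hm t ht x hx)
        (hgbb m hm x hx t (Set.Ioo_subset_Icc_self ht))) (hDirb m hm) (hNeub m hm)
  have hslice : ∀ {e : ℝ → (Fin n → ℝ) → ℝ},
      (ContDiff ℝ 2 fun q : ℝ × (Fin n → ℝ) => e q.1 q.2) → ∀ t, ContDiff ℝ 1 (e t) :=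
    fun he t => contDiff_slice (he.of_le (by norm_num)) t
  have hturn : ∀ m, 1 ≤ m →
      σ * lyap k χ (eb m (t0 + T)) (fun x => -deriv (fun s => eb m s x) (t0 + T)) ≤
        lyap k χ (ef m (t0 + T)) (fun x => deriv (fun s => ef m s x) (t0 + T)) := fun m hm => by
    have h := mul_lyap_le_lyap_neg hn hk hχ hl2 hσ0 hσ1 hΦ (hslice (hef m hm) (t0 + T))
      (continuous_deriv_slice (hef m hm) (t0 + T)).neg (hDirf m hm _ hr)
    simp only [Pi.neg_apply, neg_neg] at h
    rwa [lyap_congr (u' := ef m (t0 + T)) (v' := fun x => -deriv (fun s => ef m s x) (t0 + T))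
      ((hslice (heb m hm) _).differentiable one_ne_zero)
      ((hslice (hef m hm) _).differentiable one_ne_zero) fun x hx =>
        ⟨(hfin m hm x hx).1, by rw [(hfin m hm x hx).2]⟩]
  have hcycle : ∀ m, 1 ≤ m →
      lyap k χ (eb m t0) (fun x => -deriv (fun s => eb m s x) t0) ≤
        q * (σ * lyap k χ (ef m t0) (fun x => deriv (fun s => ef m s x) t0)) := fun m hm => by
    have h1 := mul_le_mul_of_nonneg_left (hbackward m hm) hσ0.le
    have h2 := mul_le_mul_of_nonneg_left ((hturn m hm).trans (hforward m hm)) hε0.le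
    refine le_of_mul_le_mul_left ?_ hσ0
    calc _ ≤ _ := h1
      _ = _ := mul_left_comm _ _ _
      _ ≤ _ := h2
      _ = ε * ε * _ := (mul_assoc _ _ _).symm
      _ = _ := by rw [hεσ]; ring
  have hz0n : 0 ≤ lyap k χ z0 z1 := by
    refine le_trans ?_ (lamMin_mul_integral_le_lyap hn hk hχ hl0 hΦ0 hz0 hz1 hz0D)
    exact mul_nonneg (lamMin_pos hΦ0).le (integral_nonneg fun x =>
      add_nonneg (gradSq_nonneg _ _) (sq_nonneg _))
  have hgeom : ∀ m, 1 ≤ m →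
      lyap k χ (eb m t0) (fun x => -deriv (fun s => eb m s x) t0) ≤ q ^ m * lyap k χ z0 z1 := by
    intro m hm
    induction m, hm using Nat.le_induction with
    | base =>
      refine (hcycle 1 le_rfl).trans ?_
      rw [lyap_congr (u' := z0) (v' := z1) ((hslice (hef 1 le_rfl) _).differentiable one_ne_zero)
        (hz0.differentiable one_ne_zero) hinit0, pow_one]
      exact mul_le_mul_of_nonneg_left (mul_le_of_le_one_left hz0n hσ1) hq0.le
    | succ m hm ih =>
      refine (hcycle (m + 1) (by lia)).trans ?_
      rw [pow_succ', mul_assoc]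
      refine mul_le_mul_of_nonneg_left (le_trans ?_ ih) hq0.le
      rw [lyap_congr ((hslice (hef (m + 1) (by lia)) _).differentiable one_ne_zero)
        ((hslice (heb m hm) _).differentiable one_ne_zero) (hinitm (m + 1) (by lia))]
      exact mul_lyap_le_lyap_neg hn hk hχ hl2 hσ0 hσ1 hΦ (hslice (heb m hm) t0)
        (continuous_deriv_slice (heb m hm) t0) (hDirb m hm _ hl)
  intro m hm
  have h1 := lamMin_mul_integral_le_lyap hn hk hχ hl0 hΦ0 (hslice (heb m hm) t0)
    (continuous_deriv_slice (heb m hm) t0).neg (hDirb m hm _ hl)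
  have h2 := mul_le_mul_of_nonneg_left (lyap_le hn hk hχ hl0 hz0 hz1 hz0D) (pow_pos hq0 m).le
  have h3 := (h1.trans (hgeom m hm)).trans h2
  simp only [Pi.neg_apply, neg_sq] at h3
  have hpos := lamMin_pos hΦ0
  rw [← le_div_iff₀' hpos] at h3
  refine h3.trans_eq ?_
  rw [alphaC]
  field_simp
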